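/- arXiv:1101.4792 — 3 statements merged into one kernel-verified Lean document; each statement's English description precedes it below -/
import Mathlib

section
/- Let $p \ge 5$ be a prime, $k \ge 1$ an integer, $q = p^k$, and $t \in \{1, \dots, p-1\}$. Let $S = \{(A,B) \in \mathbb{F}_q^2 : 4A^3 + 27B^2 \ne 0\}$, and for $(A,B) \in S$ let $T_{A,B} := q + 1 - \#E_{A,B}(\mathbb{F}_q)$, where $E_{A,B}$ is the elliptic curve $y^2 = x^3 + Ax + B$ over $\mathbb{F}_q$. Let $S_t = \{(A,B) \in S : T_{A,B} \equiv t \bmod p\}$. Then $\#S = q^2 - q$ and $\left| \#S_t - \frac{\#S}{p-1} \right| \le 3\, p^{\frac{3k}{2}+1}$. -/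
/-- The number of `F_q`-rational points (including the point at infinity) of the elliptic
curve `y² = x³ + Ax + B` over a finite field `F`. -/
noncomputable def curveCard (F : Type) [Field F] (A B : F) : ℕ :=
  Nat.card (WeierstrassCurve.toAffine ⟨0, 0, 0, A, B⟩ : WeierstrassCurve.Affine F).Point

section PiecePE
open Polynomial

theorem stepanov_inj {d Q P : ℕ} (hP : P = d * Q + 1)
    {i j l i' j' l' : ℕ} (hi : i < d) (hl : l < Q) (hi' : i' < d) (hl' : l' < Q)
    (h : l + Q * i + P * j = l' + Q * i' + P * j') : i = i' ∧ j = j' ∧ l = l' := by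
  have b1 : l + Q * i < P := by
    have : Q * (i + 1) ≤ Q * d := Nat.mul_le_mul_left _ hi
    rw [mul_comm d Q] at hP; rw [mul_add] at this; omega
  have b2 : l' + Q * i' < P := by
    have : Q * (i' + 1) ≤ Q * d := Nat.mul_le_mul_left _ hi'
    rw [mul_comm d Q] at hP; rw [mul_add] at this; omega
  have hj : j = j' := by
    have := congrArg (· / P) h
    simpa [Nat.add_mul_div_left _ _ (by omega : 0 < P), Nat.div_eq_of_lt b1,
      Nat.div_eq_of_lt b2] using this
  subst hj
  have h2 : l + Q * i = l' + Q * i' := by omega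
  have hi : i = i' := by
    have := congrArg (· / Q) h2
    simpa [Nat.add_mul_div_left _ _ (by omega : 0 < Q), Nat.div_eq_of_lt hl,
      Nat.div_eq_of_lt hl'] using this
  subst hi
  exact ⟨rfl, rfl, by omega⟩

theorem stepanov_zero {F : Type*} [Field F] [Fintype F] [DecidableEq F]
    (p : ℕ) [Fact p.Prime] [CharP F p] (μ P d Q m : ℕ) (hPp : P = p ^ μ)
    (hcard : Fintype.card F = P ^ 2) (hP : P = d * Q + 1) (hd : 4 ≤ d) (hQ : 1 ≤ Q)
    (f h : F[X]) (hf : f = X * h) (hh : h.coeff 0 ≠ 0) (hm : f.natDegree ≤ m) :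
    (Finset.univ.filter fun x : F => (f.eval x) ^ (Q * (P + 1)) = 1).card
      ≤ P * Q + (2 * m + 4) * P := by
  set J := Q + m + 3 with hJ
  let ι := Fin d × Fin J × Fin Q
  let L0 : (ι → F) →ₗ[F] F[X] :=
    Fintype.linearCombination F (fun a : ι => X ^ (P * a.2.2 + a.2.1) * f ^ (Q * (d - 1 - a.1)))
  set W := P * (Q - 1) + (J - 1) + (d - 1) * Q * m + 1 with hW
  have hL0 : ∀ v, L0 v ∈ degreeLT F W := by
    intro v
    simp only [L0, Fintype.linearCombination_apply]
    refine Submodule.sum_mem _ fun a _ => Submodule.smul_mem _ _ ?_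
    rw [mem_degreeLT]
    refine lt_of_le_of_lt (degree_le_natDegree) ?_
    have h1 : (X ^ (P * (a.2.2:ℕ) + a.2.1) * f ^ (Q * (d - 1 - a.1))).natDegree
       ≤ (P * a.2.2 + a.2.1) + (Q * (d - 1 - a.1)) * m := by
      refine natDegree_mul_le.trans ?_
      rw [natDegree_X_pow]
      gcongr
      exact natDegree_pow_le.trans (Nat.mul_le_mul_left _ hm)
    have h2 : P * (a.2.2 : ℕ) ≤ P * (Q - 1) := Nat.mul_le_mul_left _ (by have := a.2.2.2; omega)
    have h3 : (Q * (d - 1 - a.1)) * m ≤ (d - 1) * Q * m := by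
      rw [mul_comm Q]
      exact Nat.mul_le_mul_right _ (Nat.mul_le_mul_right _ (Nat.sub_le _ _))
    have h4 := a.2.1.2
    exact_mod_cast (by omega : (X ^ (P * (a.2.2:ℕ) + a.2.1) * f ^ (Q * (d - 1 - a.1))).natDegree < W)
  let L : (ι → F) →ₗ[F] degreeLT F W := L0.codRestrict _ hL0
  have hker : LinearMap.ker L ≠ ⊥ := by
    apply LinearMap.ker_ne_bot_of_finrank_lt
    have e : Module.finrank F (degreeLT F W) = W := by
      rw [(degreeLTEquiv F W).finrank_eq]; simp
    rw [e]
    simp only [ι, Module.finrank_fintype_fun_eq_card, Fintype.card_prod, Fintype.card_fin]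
    rw [hW, hJ]
    obtain ⟨Q', rfl⟩ : ∃ Q', Q = Q' + 1 := ⟨Q - 1, by omega⟩
    obtain ⟨d', rfl⟩ : ∃ d', d = d' + 4 := ⟨d - 4, by omega⟩
    rw [hP]
    simp only [Nat.add_sub_cancel, show d' + 4 - 1 = d' + 3 by omega,
      show Q' + 1 + m + 3 - 1 = Q' + m + 3 by omega]
    nlinarith [Nat.zero_le (d' * Q'), Nat.zero_le (Q' * m), Nat.zero_le (d' * Q' * m),
      Nat.zero_le (d' * m)]
  obtain ⟨v, hv, hv0⟩ := (Submodule.ne_bot_iff _).1 hker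
  have hLv : L0 v = 0 := by
    have := LinearMap.mem_ker.1 hv
    simpa [L] using congrArg Subtype.val this
  simp only [L0, Fintype.linearCombination_apply] at hLv
  let Φ : F[X] := ∑ a : ι, C (v a ^ P) * (X ^ ((a.2.2 : ℕ) + P * a.2.1) * f ^ (Q * (a.1 : ℕ)))
  have hqq : ∀ x : F, x ^ (P * P) = x := fun x => by
    rw [← sq, ← hcard]; exact FiniteField.pow_card x
  -- vanishing
  have hvan : ∀ x : F, (f.eval x) ^ (Q * (P + 1)) = 1 → Φ.eval x = 0 := by
    intro x hx
    have hne : f.eval x ≠ 0 := by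
      intro h0; rw [h0, zero_pow (by positivity)] at hx; exact zero_ne_one hx
    have key : (Φ.eval x) ^ P * (f.eval x) ^ (Q * (d - 1)) = 0 := by
      have := congrArg (eval x) hLv
      rw [eval_zero] at this
      rw [← this]
      simp only [Φ, eval_finsetSum]
      rw [hPp, sum_pow_char_pow, ← hPp, Finset.sum_mul]
      refine Finset.sum_congr rfl fun a _ => ?_
      simp only [eval_mul, eval_C, eval_pow, eval_X, eval_smul, smul_eq_mul, mul_pow]
      rw [← pow_mul (v a), hqq, mul_assoc, mul_assoc]
      congr 1
      rw [← pow_mul, add_mul, pow_add, show P * (a.2.1:ℕ) * P = (P * P) * (a.2.1 : ℕ) by ring,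
        pow_mul x (P * P), hqq, mul_comm (a.2.2 : ℕ) P, ← pow_add]
      congr 1
      rw [← pow_mul, ← pow_add]
      have hi := a.1.2
      rw [show Q * (a.1 : ℕ) * P + Q * (d - 1) = Q * (d - 1 - a.1) + Q * (P + 1) * a.1 by
        have : d - 1 = (d - 1 - a.1) + a.1 := by omega
        rw [this]; simp only [Nat.add_sub_cancel]; ring]
      rw [pow_add, pow_mul _ (Q * (P + 1)), hx, one_pow, mul_one]
    rcases mul_eq_zero.1 key with h | h
    · exact pow_eq_zero_iff (by omega : P ≠ 0) |>.1 h
    · exact absurd h (pow_ne_zero _ hne)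
  -- nonvanishing
  have hΦ : Φ ≠ 0 := by
    let e : ι → ℕ := fun a => (a.2.2 : ℕ) + Q * a.1 + P * a.2.1
    have hinj : ∀ a b, e a = e b → a = b := by
      rintro ⟨i, j, l⟩ ⟨i', j', l'⟩ h
      obtain ⟨h1, h2, h3⟩ := stepanov_inj hP i.2 l.2 i'.2 l'.2 h
      exact Prod.ext (Fin.ext h1) (Prod.ext (Fin.ext h2) (Fin.ext h3))
    obtain ⟨a0, ha0⟩ : ∃ a, v a ≠ 0 := Function.ne_iff.1 hv0
    obtain ⟨b, hb, hbmin⟩ := Finset.exists_min_image (Finset.univ.filter fun a => v a ≠ 0) e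
      ⟨a0, by simpa using ha0⟩
    have hb' : v b ≠ 0 := by simpa using hb
    intro h0
    have hc := congrArg (fun g => coeff g (e b)) h0
    simp only [Φ, finsetSum_coeff, coeff_zero] at hc
    have hterm : ∀ a : ι, C (v a ^ P) * (X ^ ((a.2.2 : ℕ) + P * a.2.1) * f ^ (Q * (a.1 : ℕ)))
        = C (v a ^ P) * (h ^ (Q * (a.1 : ℕ)) * X ^ (e a)) := by
      intro a
      rw [hf, mul_pow]; congr 1
      simp only [e]; ring
    simp only [hterm, coeff_C_mul] at hc
    rw [Finset.sum_eq_single b] at hc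
    · rw [coeff_mul_X_pow', if_pos le_rfl, Nat.sub_self, coeff_zero_eq_eval_zero, eval_pow,
        ← coeff_zero_eq_eval_zero] at hc
      exact mul_ne_zero (pow_ne_zero _ hb') (pow_ne_zero _ hh) hc
    · intro a _ hab
      by_cases hva : v a = 0
      · rw [hva, zero_pow (by omega), zero_mul]
      · have := hbmin a (by simpa using hva)
        have hne : e a ≠ e b := fun h => hab (hinj _ _ h)
        rw [coeff_mul_X_pow', if_neg (by omega), mul_zero]
    · intro h; simp at h
  have hdeg : Φ.natDegree ≤ (Q - 1) + P * (J - 1) + (d - 1) * Q * m := by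
    refine natDegree_sum_le_of_forall_le _ _ fun a _ => ?_
    refine (natDegree_C_mul_le _ _).trans (natDegree_mul_le.trans ?_)
    rw [natDegree_X_pow]
    have h1 : (f ^ (Q * (a.1:ℕ))).natDegree ≤ (d - 1) * Q * m := by
      refine natDegree_pow_le.trans ?_
      have := a.1.2
      calc Q * (a.1 : ℕ) * f.natDegree ≤ Q * (d - 1) * m := by gcongr; omega
        _ = _ := by ring
    have h2 : P * (a.2.1 : ℕ) ≤ P * (J - 1) := Nat.mul_le_mul_left _ (by have := a.2.1.2; omega)
    have h3 := a.2.2.2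
    omega
  have hcardle : (Finset.univ.filter fun x : F => (f.eval x) ^ (Q * (P + 1)) = 1).card
      ≤ Φ.natDegree := by
    refine le_trans (Finset.card_le_card (t := Φ.roots.toFinset) ?_)
      ((Multiset.toFinset_card_le _).trans (card_roots' _))
    intro x hx
    simp only [Finset.mem_filter, Finset.mem_univ, true_and] at hx
    simp [hΦ, hvan x hx]
  refine hcardle.trans (hdeg.trans ?_)
  have h1 : J - 1 = Q + m + 2 := by omega
  rw [h1]
  have h2 : (d - 1) * Q * m ≤ m * P := by
    rw [mul_comm]
    gcongr
    rw [hP]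
    nlinarith [Nat.sub_le d 1]
  have h3 : Q ≤ P := by rw [hP]; nlinarith
  have h4 : Q - 1 ≤ P := by omega
  nlinarith

theorem stepanov {F : Type*} [Field F] [Fintype F] [DecidableEq F]
    (p : ℕ) [Fact p.Prime] [CharP F p] (μ P d Q m : ℕ) (hPp : P = p ^ μ)
    (hcard : Fintype.card F = P ^ 2) (hP : P = d * Q + 1) (hd : 4 ≤ d) (hQ : 1 ≤ Q)
    (f h : F[X]) (x₀ c : F) (hf : f = (X - C x₀) * h) (hh : h.eval x₀ ≠ 0) (hm : f.natDegree ≤ m)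
    (hc : c ≠ 0) :
    (Finset.univ.filter fun x : F => (c * f.eval x) ^ (Q * (P + 1)) = 1).card
      ≤ P * Q + (2 * m + 4) * P := by
  have := stepanov_zero p μ P d Q m hPp hcard hP hd hQ (C c * f.comp (X + C x₀))
    (C c * h.comp (X + C x₀)) (by rw [hf]; simp; ring) (by
      simp [coeff_zero_eq_eval_zero, hc, hh]) (by
      refine (natDegree_C_mul_le _ _).trans ?_
      refine natDegree_comp_le.trans ?_
      simpa using hm)
  refine le_trans (le_of_eq ?_) this
  refine Finset.card_bij' (fun x _ => x - x₀) (fun x _ => x + x₀) ?_ ?_ ?_ ?_ <;> simp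

end PiecePE

section PiecePG
open Filter Topology

theorem powersum_bound {ι : Type*} [Fintype ι] (z : ι → ℂ) (R C : ℝ) (hR : 0 < R) (N₀ : ℕ)
    (h : ∀ n ≥ N₀, ‖∑ i, z i ^ n‖ ≤ C * R ^ n) (i : ι) : ‖z i‖ ≤ R := by
  by_contra! hlt
  let u : ι → Circle := fun i => Circle.exp (z i).arg
  have hu : ∀ i, z i = (‖z i‖ : ℂ) * (u i : ℂ) := by
    intro i
    simp [u, Circle.coe_exp]
  have hcl : MapClusterPt 1 atTop (u ^ · : ℕ → (ι → Circle)) := mapClusterPt_one_atTop_pow u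
  have hU : {w : ι → Circle | ∀ i, (1/2 : ℝ) < ((w i : Circle) : ℂ).re} ∈ 𝓝 (1 : ι → Circle) := by
    have hopen : IsOpen {w : ι → Circle | ∀ i, (1/2 : ℝ) < ((w i : Circle) : ℂ).re} := by
      simp only [Set.ofPred_forall]
      refine isOpen_iInter_of_finite fun i => ?_
      refine isOpen_lt continuous_const ?_
      exact Complex.continuous_re.comp (continuous_subtype_val.comp (continuous_apply i))
    refine hopen.mem_nhds ?_
    intro i
    simp
    norm_num
  have hfr := hcl.frequently hU
  have hev : ∀ᶠ n : ℕ in atTop, 2 * C < (‖z i‖ / R) ^ n :=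
    (tendsto_pow_atTop_atTop_of_one_lt ((one_lt_div hR).2 hlt)).eventually_gt_atTop _
  obtain ⟨n, hn, hn2, hn3⟩ := (hfr.and_eventually (hev.and (eventually_ge_atTop N₀))).exists
  have h1 := h n hn3
  have h2 : (∑ i, z i ^ n).re ≤ C * R ^ n := (Complex.re_le_norm _).trans h1
  have h3 : ∀ j, (1/2) * ‖z j‖ ^ n ≤ (z j ^ n).re := by
    intro j
    have hj : (1/2 : ℝ) < ((u j ^ n : Circle) : ℂ).re := hn j
    have e : (z j ^ n) = ((‖z j‖ ^ n : ℝ) : ℂ) * ((u j ^ n : Circle) : ℂ) := by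
      conv_lhs => rw [hu j]
      push_cast; rw [mul_pow]
    rw [e, Complex.re_ofReal_mul]
    have : 0 ≤ ‖z j‖ ^ n := by positivity
    nlinarith
  have h4 : (1/2) * ‖z i‖ ^ n ≤ (∑ i, z i ^ n).re := by
    rw [Complex.re_sum]
    refine (h3 i).trans ?_
    refine Finset.single_le_sum (f := fun j => (z j ^ n).re) (fun j _ => ?_) (Finset.mem_univ i)
    exact le_trans (by positivity) (h3 j)
  have h5 : 2 * C * R ^ n < ‖z i‖ ^ n := by
    rw [div_pow] at hn2
    rwa [lt_div_iff₀ (by positivity)] at hn2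
  linarith

theorem powersum_bound' {ι : Type*} [Fintype ι] (z : ι → ℂ) (R C : ℝ) (hR : 0 < R) (N₀ K : ℕ)
    (hK : 0 < K)
    (h : ∀ n ≥ N₀, ‖∑ i, z i ^ (K * n)‖ ≤ C * R ^ (K * n)) (i : ι) : ‖z i‖ ≤ R := by
  have := powersum_bound (fun i => z i ^ K) (R ^ K) C (by positivity) N₀ (by
    simpa only [pow_mul] using h) i
  rw [norm_pow] at this
  exact le_of_pow_le_pow_left₀ hK.ne' hR.le this


noncomputable def geomS (z : ℂ) : PowerSeries ℂ := PowerSeries.mk fun k => if k = 0 then 0 else -z ^ k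

theorem geomS_mul (z : ℂ) :
    geomS z * (1 - PowerSeries.C z * PowerSeries.X) = - (PowerSeries.C z * PowerSeries.X) := by
  ext n
  rw [mul_sub, mul_one, mul_comm (PowerSeries.C z), ← mul_assoc, ]
  rcases n with _ | n
  · simp [geomS]
  · rw [map_sub, PowerSeries.coeff_mul_C, PowerSeries.coeff_succ_mul_X, map_neg,
      mul_comm PowerSeries.X, PowerSeries.coeff_succ_mul_X, PowerSeries.coeff_C]
    simp only [geomS, PowerSeries.coeff_mk]
    rcases n with _ | n
    · simp
    · simp [pow_succ]

theorem geomS_prod (M : Multiset ℂ) :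
    PowerSeries.X * PowerSeries.derivative ℂ (M.map fun z => 1 - PowerSeries.C z * PowerSeries.X).prod
      = (M.map geomS).sum * (M.map fun z => 1 - PowerSeries.C z * PowerSeries.X).prod := by
  induction M using Multiset.induction_on with
  | empty => simp
  | cons z M ih =>
    rw [Multiset.map_cons, Multiset.prod_cons, Multiset.map_cons, Multiset.sum_cons,
      Derivation.leibniz]
    have hd : PowerSeries.derivative ℂ (1 - PowerSeries.C z * PowerSeries.X) = - PowerSeries.C z := by
      ext n
      simp [PowerSeries.coeff_derivative, PowerSeries.coeff_one, PowerSeries.coeff_X, PowerSeries.coeff_C]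
    rw [hd]
    simp only [smul_eq_mul]
    have := geomS_mul z
    linear_combination (1 - PowerSeries.C z * PowerSeries.X) * ih -
      (M.map fun z => 1 - PowerSeries.C z * PowerSeries.X).prod * this

/-- Newton-type recursion for a logarithmic derivative identity. -/
theorem newton_roots (m : ℕ) (l S : ℕ → ℂ) (hl0 : l 0 = 1) (hlm : ∀ N ≥ m, l N = 0)
    (hrec : ∀ N : ℕ, (N : ℂ) * l N =
      ∑ x ∈ Finset.HasAntidiagonal.antidiagonal N, (if x.1 = 0 then 0 else S x.1) * l x.2) :
    ∃ (n : ℕ) (z : Fin n → ℂ), n ≤ m ∧ ∀ k ≥ 1, S k = - ∑ i, z i ^ k := by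
  let L : Polynomial ℂ := ∑ j ∈ Finset.range m, Polynomial.monomial j (l j)
  have hLc : ∀ j, L.coeff j = l j := by
    intro j
    simp only [L, Polynomial.finsetSum_coeff, Polynomial.coeff_monomial]
    rw [Finset.sum_ite_eq']
    split_ifs with h
    · rfl
    · exact (hlm j (by simpa using h)).symm
  have hLne : L ≠ 0 := by
    intro h; have := hLc 0; rw [h, hl0] at this; simp at this
  have hLdeg : L.natDegree ≤ m := by
    refine Polynomial.natDegree_le_iff_coeff_eq_zero.2 fun N hN => ?_
    rw [hLc]; exact hlm N hN.le
  have hroot0 : ∀ a ∈ L.roots, a ≠ 0 := by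
    rintro a ha rfl
    have := (Polynomial.mem_roots hLne).1 ha
    rw [Polynomial.IsRoot.def, ← Polynomial.coeff_zero_eq_eval_zero, hLc, hl0] at this
    exact one_ne_zero this
  let M : Multiset ℂ := L.roots.map (fun a => a⁻¹)
  have hsplit : (L.roots.map fun a => Polynomial.X - Polynomial.C a).prod * Polynomial.C L.leadingCoeff = L := by
    rw [mul_comm]
    exact Polynomial.C_leadingCoeff_mul_prod_multiset_X_sub_C
      ((IsAlgClosed.splits L).natDegree_eq_card_roots.symm)
  have hLprod : L = (M.map fun z => 1 - Polynomial.C z * Polynomial.X).prod := by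
    have h1 : ∀ s : Multiset ℂ, (∀ a ∈ s, a ≠ 0) →
        (s.map fun a => Polynomial.X - Polynomial.C a).prod =
        Polynomial.C (s.map fun a => -a).prod *
          ((s.map (fun a => a⁻¹)).map fun z => 1 - Polynomial.C z * Polynomial.X).prod := by
      intro s
      induction s using Multiset.induction_on with
      | empty => simp
      | cons a s ih =>
        intro hs
        have ha : a ≠ 0 := hs a (Multiset.mem_cons_self _ _)
        have e : (Polynomial.X - Polynomial.C a : Polynomial ℂ) =
            Polynomial.C (-a) * (1 - Polynomial.C a⁻¹ * Polynomial.X) := by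
          rw [mul_sub, ← mul_assoc, ← Polynomial.C_mul]
          simp [ha]
          ring
        simp only [Multiset.map_cons, Multiset.prod_cons]
        rw [ih fun b hb => hs b (Multiset.mem_cons_of_mem hb), e, Polynomial.C_mul]
        ring
    have h2 := h1 L.roots hroot0
    rw [h2] at hsplit
    have h3 : Polynomial.C (L.roots.map fun a => -a).prod * Polynomial.C L.leadingCoeff = 1 := by
      rw [← Polynomial.C_mul]
      have := congrArg (Polynomial.eval 0) hsplit
      rw [← Polynomial.coeff_zero_eq_eval_zero L, hLc, hl0] at this
      simp only [Polynomial.eval_mul, Polynomial.eval_C, Polynomial.eval_multiset_prod,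
        Multiset.map_map] at this
      rw [← Polynomial.C_1]
      congr 1
      simpa using this
    calc L = _ := hsplit.symm
      _ = (Polynomial.C (L.roots.map fun a => -a).prod * Polynomial.C L.leadingCoeff) * _ := by
        rw [mul_right_comm]
      _ = _ := by rw [h3, one_mul]
  have hLps : (L : PowerSeries ℂ) = (M.map fun z => 1 - PowerSeries.C z * PowerSeries.X).prod := by
    conv_lhs => rw [hLprod]
    rw [← Polynomial.coeToPowerSeries.ringHom_apply, map_multiset_prod, Multiset.map_map]
    congr 1
    refine Multiset.map_congr rfl fun z _ => ?_
    simp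
  let SS : PowerSeries ℂ := PowerSeries.mk fun k => if k = 0 then 0 else S k
  have hSL : PowerSeries.X * PowerSeries.derivative ℂ (L : PowerSeries ℂ) = SS * (L : PowerSeries ℂ) := by
    ext N
    rw [PowerSeries.coeff_mul N SS]
    simp only [SS, PowerSeries.coeff_mk, Polynomial.coeff_coe, hLc]
    rw [← hrec]
    rcases N with _ | N
    · simp
    · rw [mul_comm, PowerSeries.coeff_succ_mul_X, PowerSeries.coeff_derivative, Polynomial.coeff_coe, hLc]
      push_cast; ring
  have hEq : SS = (M.map geomS).sum := by
    have hne : (L : PowerSeries ℂ) ≠ 0 := by simpa using hLne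
    apply mul_right_cancel₀ hne
    rw [← hSL, hLps, geomS_prod]
  refine ⟨M.toList.length, fun i => M.toList.get i, ?_, ?_⟩
  · simp only [Multiset.length_toList, M, Multiset.card_map]
    exact (Polynomial.card_roots' L).trans hLdeg
  · intro k hk
    have := congrArg (PowerSeries.coeff k) hEq
    simp only [SS, PowerSeries.coeff_mk, if_neg (by omega : k ≠ 0)] at this
    rw [this, map_multiset_sum, Multiset.map_map]
    conv_lhs => rw [← Multiset.coe_toList M]
    rw [Multiset.map_coe, Multiset.sum_coe, ← Finset.sum_neg_distrib]
    rw [← List.sum_ofFn]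
    congr 1
    refine List.ext_get (by simp) fun n h1 h2 => ?_
    simp [geomS]
    omega

end PiecePG

section PiecePF
open Polynomial

section LFun
variable (K : Type*) [Field K] [Finite K]

theorem monics_finite (N : ℕ) : {h : K[X] | h.Monic ∧ h.natDegree = N}.Finite := by
  have : Finite (degreeLT K (N + 1)) := Finite.of_equiv _ (degreeLTEquiv K (N + 1)).symm.toEquiv
  refine Set.Finite.subset (Set.toFinite (degreeLT K (N + 1) : Set K[X])) ?_
  rintro h ⟨hm, hd⟩
  rw [SetLike.mem_coe, mem_degreeLT, degree_eq_natDegree hm.ne_zero, hd]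
  exact_mod_cast Nat.lt_succ_self N

noncomputable def monics (N : ℕ) : Finset K[X] := (monics_finite K N).toFinset

variable {K}

@[simp] theorem mem_monics {N : ℕ} {h : K[X]} : h ∈ monics K N ↔ h.Monic ∧ h.natDegree = N := by
  simp [monics]

noncomputable def lam (f : K[X]) (χ : MulChar K ℂ) (h : K[X]) : ℂ := χ (resultant h f)

theorem lam_mul (f : K[X]) (χ : MulChar K ℂ) {h₁ h₂ : K[X]} (hm₁ : h₁.Monic) (hm₂ : h₂.Monic) :
    lam f χ (h₁ * h₂) = lam f χ h₁ * lam f χ h₂ := by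
  simp only [lam]
  rw [hm₁.natDegree_mul hm₂, resultant_mul_left _ _ _ _ le_rfl, map_mul]

theorem lam_one (f : K[X]) (χ : MulChar K ℂ) : lam f χ 1 = 1 := by
  simp [lam]

theorem lam_pow (f : K[X]) (χ : MulChar K ℂ) {h : K[X]} (hm : h.Monic) (j : ℕ) :
    lam f χ (h ^ j) = lam f χ h ^ j := by
  induction j with
  | zero => simp [lam_one]
  | succ j ih => rw [pow_succ, lam_mul f χ (hm.pow j) hm, ih, pow_succ]

noncomputable def lSum (f : K[X]) (χ : MulChar K ℂ) (N : ℕ) : ℂ := ∑ h ∈ monics K N, lam f χ h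

theorem lsum_zero (f : K[X]) (χ : MulChar K ℂ) : lSum f χ 0 = 1 := by
  have : monics K 0 = {1} := by
    ext h; simp only [mem_monics, Finset.mem_singleton]
    constructor
    · rintro ⟨h1, h2⟩; exact h1.natDegree_eq_zero.1 h2
    · rintro rfl; simp
  simp [lSum, this, lam_one]

/-- the twisting constant -/
noncomputable def ctw (f : K[X]) : K := (-1) ^ f.natDegree * f.leadingCoeff

theorem lsum_eq_zero (f : K[X]) (χ : MulChar K ℂ) (hf : f ≠ 0) (u : K[X]) (hu : u.Monic)
    (hcop : IsCoprime u f) (hne : lam f χ u ≠ χ (ctw f) ^ u.natDegree) (N : ℕ)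
    (hN : f.natDegree ≤ N) (hf1 : 1 ≤ f.natDegree): lSum f χ N = 0 := by
  classical
  let σ : K[X] → K[X] := fun h => (h - h % f) + (u * h) % f
  have hmod : ∀ h : K[X], (h % f).degree < f.degree := fun h => EuclideanDomain.mod_lt h hf
  have hσmem : ∀ h ∈ monics K N, σ h ∈ monics K N := by
    intro h hh
    rw [mem_monics] at hh ⊢
    have hd : (-(h % f) + (u * h) % f).degree < h.degree := by
      have h1 : f.degree ≤ h.degree := by
        rw [degree_eq_natDegree hf, degree_eq_natDegree hh.1.ne_zero, hh.2]; exact_mod_cast hN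
      refine lt_of_lt_of_le (lt_of_le_of_lt (degree_add_le _ _) ?_) h1
      rw [degree_neg]
      exact max_lt (hmod _) (hmod _)
    have e : σ h = h + (-(h % f) + (u * h) % f) := by simp only [σ]; ring
    rw [e]
    refine ⟨hh.1.add_of_left hd, ?_⟩
    rw [natDegree_eq_of_degree_eq (degree_add_eq_left_of_degree_lt hd), hh.2]
  have hquot : ∀ h : K[X], σ h = f * (h / f) + (u * h) % f := by
    intro h
    have := EuclideanDomain.div_add_mod h f
    simp only [σ]
    linear_combination -this
  have hσmod : ∀ h : K[X], f ∣ u * h - σ h := by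
    intro h
    rw [hquot]
    have := EuclideanDomain.div_add_mod (u * h) f
    refine ⟨(u * h) / f - h / f, ?_⟩
    linear_combination -this
  have hσinj : Set.InjOn σ (monics K N) := by
    intro h _ h' _ heq
    have hdd : f ∣ u * h - u * h' := by
      have h1 := hσmod h
      have h2 := hσmod h'
      rw [heq] at h1
      simpa using dvd_sub h1 h2
    have hdd2 : f ∣ h - h' := by
      rw [← mul_sub] at hdd
      exact hcop.symm.dvd_of_dvd_mul_left hdd
    have hm1 : h % f = h' % f := by
      rw [← sub_eq_zero]
      have : f ∣ h % f - h' % f := by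
        have e1 := EuclideanDomain.div_add_mod h f
        have e2 := EuclideanDomain.div_add_mod h' f
        obtain ⟨c, hc⟩ := hdd2
        exact ⟨c - h / f + h' / f, by linear_combination hc + e1 - e2⟩
      refine eq_zero_of_dvd_of_degree_lt this ?_
      exact lt_of_le_of_lt (degree_sub_le _ _) (max_lt (hmod _) (hmod _))
    have hm2 : (u * h) % f = (u * h') % f := by
      rw [← sub_eq_zero]
      have : f ∣ (u * h) % f - (u * h') % f := by
        have e1 := EuclideanDomain.div_add_mod (u * h) f
        have e2 := EuclideanDomain.div_add_mod (u * h') f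
        obtain ⟨c, hc⟩ := hdd
        exact ⟨c - (u * h) / f + (u * h') / f, by linear_combination hc + e1 - e2⟩
      refine eq_zero_of_dvd_of_degree_lt this ?_
      exact lt_of_le_of_lt (degree_sub_le _ _) (max_lt (hmod _) (hmod _))
    simp only [σ] at heq
    rw [hm1, hm2] at heq
    linear_combination heq
  have hlam : ∀ h ∈ monics K N, lam f χ u * lam f χ h = χ (ctw f) ^ u.natDegree * lam f χ (σ h) := by
    intro h hh
    have hs := hσmem h hh
    rw [mem_monics] at hh hs
    rw [← lam_mul f χ hu hh.1]
    simp only [lam]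
    rw [← map_pow, ← map_mul]
    congr 1
    obtain ⟨c, hc⟩ := hσmod h
    have e : u * h = σ h + f * c := by linear_combination hc
    rw [hu.natDegree_mul hh.1, hh.2, e, resultant_add_mul_left, hs.2, add_comm,
      resultant_add_left_deg _ _ _ _ _ (by rw [hs.2])]
    · congr 1
      rw [ctw, mul_pow, ← pow_mul]; rfl
    · by_cases hc0 : c = 0
      · rw [hc0]; simp; omega
      · have : (f * c).natDegree ≤ u.natDegree + N := by
          rw [show f * c = u * h - σ h from hc.symm]
          refine (natDegree_sub_le _ _).trans ?_
          rw [hu.natDegree_mul hh.1, hh.2, hs.2]; simp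
        rw [natDegree_mul hf hc0] at this
        omega
    · exact le_rfl
  have himg : (monics K N).image σ = monics K N := by
    apply Finset.eq_of_subset_of_card_le
    · intro g hg
      obtain ⟨h, hh, rfl⟩ := Finset.mem_image.1 hg
      exact hσmem h hh
    · rw [Finset.card_image_of_injOn hσinj]
  have hsum : lam f χ u * lSum f χ N = χ (ctw f) ^ u.natDegree * lSum f χ N := by
    conv_rhs => rw [lSum, ← himg, Finset.sum_image hσinj]
    rw [lSum, Finset.mul_sum, Finset.mul_sum]
    exact Finset.sum_congr rfl hlam
  by_contra h0
  exact hne (mul_right_cancel₀ h0 hsum)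

/-- monic irreducibles of degree r -/
noncomputable def irrs (K : Type*) [Field K] [Finite K] (r : ℕ) : Finset K[X] := by
  classical exact (monics K r).filter Irreducible

theorem mem_irrs {r : ℕ} {P : K[X]} : P ∈ irrs K r ↔ (P.Monic ∧ P.natDegree = r) ∧ Irreducible P := by
  simp [irrs]

theorem natDegree_eq_sum (h : K[X]) (hm : h.Monic) (N : ℕ) (hN : h.natDegree = N) :
    (N : ℂ) = ∑ r ∈ Finset.Icc 1 N, ∑ P ∈ irrs K r, ∑ j ∈ Finset.Icc 1 N,
      (open scoped Classical in if P ^ j ∣ h then (r : ℂ) else 0) := by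
  classical
  have hprod : (UniqueFactorizationMonoid.normalizedFactors h).prod = h := by
    rw [UniqueFactorizationMonoid.prod_normalizedFactors_eq hm.ne_zero, hm.normalize_eq_self]
  have hmon : ∀ P ∈ UniqueFactorizationMonoid.normalizedFactors h, P.Monic := by
    intro P hP
    have h1 := UniqueFactorizationMonoid.normalize_normalized_factor P hP
    have h2 := (UniqueFactorizationMonoid.irreducible_of_normalized_factor P hP).ne_zero
    rw [← h1]; exact monic_normalize h2
  have hdeg : N = ((UniqueFactorizationMonoid.normalizedFactors h).map natDegree).sum := by
    rw [← natDegree_multiset_prod_of_monic _ hmon, hprod, hN]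
  rw [Finset.sum_multiset_map_count] at hdeg
  have hinner : ∀ r ∈ Finset.Icc 1 N, ∀ P ∈ irrs K r, ∑ j ∈ Finset.Icc 1 N,
      (if P ^ j ∣ h then (r : ℂ) else 0) =
       ((UniqueFactorizationMonoid.normalizedFactors h).count P : ℂ) * P.natDegree := by
    intro r hr P hP
    obtain ⟨⟨hPm, hPr⟩, hPi⟩ := mem_irrs.1 hP
    set c := (UniqueFactorizationMonoid.normalizedFactors h).count P with hc
    have hiff : ∀ j, P ^ j ∣ h ↔ j ≤ c := by
      intro j
      rw [pow_dvd_iff_le_emultiplicity,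
        UniqueFactorizationMonoid.emultiplicity_eq_count_normalizedFactors hPi hm.ne_zero,
        hPm.normalize_eq_self]
      exact_mod_cast Iff.rfl
    have hcN : c ≤ N := by
      have h1 := (hiff c).2 le_rfl
      have h2 := natDegree_le_of_dvd h1 hm.ne_zero
      rw [natDegree_pow, hN, hPr] at h2
      have := (Finset.mem_Icc.1 hr).1
      nlinarith
    simp only [hiff]
    rw [← Finset.sum_filter, Finset.sum_const]
    have : (Finset.Icc 1 N).filter (fun j => j ≤ c) = Finset.Icc 1 c := by
      ext j; simp only [Finset.mem_filter, Finset.mem_Icc]; omega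
    rw [this, hPr]; simp
  rw [Finset.sum_congr rfl fun r hr => Finset.sum_congr rfl (hinner r hr)]
  rw [Finset.sum_sigma']
  conv_lhs => rw [hdeg]
  push_cast
  simp only [smul_eq_mul, Nat.cast_mul]
  symm
  rw [← Finset.sum_subset (s₁ := ((Finset.Icc 1 N).sigma fun r => irrs K r).filter
    (fun x => x.2 ∈ UniqueFactorizationMonoid.normalizedFactors h)) (Finset.filter_subset _ _)]
  · refine Finset.sum_bij (fun x _ => x.2) ?_ ?_ ?_ ?_
    · intro x hx
      exact Multiset.mem_toFinset.2 (Finset.mem_filter.1 hx).2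
    · rintro ⟨r, P⟩ hx ⟨r', P'⟩ hx' heq
      simp only [Finset.mem_filter, Finset.mem_sigma, mem_irrs] at hx hx' heq
      subst heq
      have : r = r' := by rw [← hx.1.2.1.2, ← hx'.1.2.1.2]
      subst this; rfl
    · intro P hP
      rw [Multiset.mem_toFinset] at hP
      have hirr := UniqueFactorizationMonoid.irreducible_of_normalized_factor P hP
      refine ⟨⟨P.natDegree, P⟩, ?_, rfl⟩
      simp only [Finset.mem_filter, Finset.mem_sigma, mem_irrs, Finset.mem_Icc]
      refine ⟨⟨⟨hirr.natDegree_pos, ?_⟩, ⟨hmon P hP, by simp⟩, hirr⟩, hP⟩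
      rw [← hN]
      exact natDegree_le_of_dvd (UniqueFactorizationMonoid.dvd_of_mem_normalizedFactors hP) hm.ne_zero
    · intro x hx; rfl
  · intro x hx hx2
    have : x.2 ∉ UniqueFactorizationMonoid.normalizedFactors h := by
      intro h3; exact hx2 (Finset.mem_filter.2 ⟨hx, h3⟩)
    rw [Multiset.count_eq_zero_of_notMem this]; simp

theorem lsum_dvd (f : K[X]) (χ : MulChar K ℂ) (N : ℕ) (D : K[X]) (hD : D.Monic) :
    (open scoped Classical in ∑ h ∈ (monics K N).filter (fun h => D ∣ h), lam f χ h) =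
      if D.natDegree ≤ N then lam f χ D * lSum f χ (N - D.natDegree) else 0 := by
  classical
  split_ifs with h
  · rw [lSum, Finset.mul_sum]
    symm
    refine Finset.sum_bij (fun g _ => D * g) ?_ ?_ ?_ ?_
    · intro g hg
      rw [mem_monics] at hg
      simp only [Finset.mem_filter, mem_monics]
      refine ⟨⟨hD.mul hg.1, ?_⟩, dvd_mul_right _ _⟩
      rw [hD.natDegree_mul hg.1, hg.2]; omega
    · intro a _ b _ hab
      exact mul_left_cancel₀ hD.ne_zero hab
    · intro b hb
      simp only [Finset.mem_filter, mem_monics] at hb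
      obtain ⟨⟨hb1, hb2⟩, g, rfl⟩ := hb
      have hg : g.Monic := hD.of_mul_monic_left hb1
      refine ⟨g, ?_, rfl⟩
      rw [hD.natDegree_mul hg] at hb2
      rw [mem_monics]; exact ⟨hg, by omega⟩
    · intro g hg
      rw [mem_monics] at hg
      rw [lam_mul f χ hD hg.1]
  · rw [Finset.filter_false_of_mem, Finset.sum_empty]
    intro g hg hdvd
    rw [mem_monics] at hg
    have := natDegree_le_of_dvd hdvd hg.1.ne_zero
    omega

noncomputable def psumS (f : K[X]) (χ : MulChar K ℂ) (k : ℕ) : ℂ :=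
  ∑ x ∈ k.divisorsAntidiagonal, ∑ P ∈ irrs K x.1, (x.1 : ℂ) * lam f χ P ^ x.2

theorem lsum_rec (f : K[X]) (χ : MulChar K ℂ) (N : ℕ) :
    (N : ℂ) * lSum f χ N = ∑ x ∈ Finset.HasAntidiagonal.antidiagonal N,
      (if x.1 = 0 then 0 else psumS f χ x.1) * lSum f χ x.2 := by
  classical
  have hL : (N : ℂ) * lSum f χ N = ∑ r ∈ Finset.Icc 1 N, ∑ P ∈ irrs K r, ∑ j ∈ Finset.Icc 1 N,
      if r * j ≤ N then (r : ℂ) * lam f χ P ^ j * lSum f χ (N - r * j) else 0 := by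
    rw [lSum, Finset.mul_sum]
    have : ∀ h ∈ monics K N, (N : ℂ) * lam f χ h = ∑ r ∈ Finset.Icc 1 N, ∑ P ∈ irrs K r,
        ∑ j ∈ Finset.Icc 1 N, (if P ^ j ∣ h then (r : ℂ) * lam f χ h else 0) := by
      intro h hh
      rw [mem_monics] at hh
      rw [natDegree_eq_sum h hh.1 N hh.2]
      simp only [Finset.sum_mul, ite_mul, zero_mul]
    rw [Finset.sum_congr rfl this, Finset.sum_comm]
    refine Finset.sum_congr rfl fun r hr => ?_
    rw [Finset.sum_comm]
    refine Finset.sum_congr rfl fun P hP => ?_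
    rw [Finset.sum_comm]
    refine Finset.sum_congr rfl fun j hj => ?_
    obtain ⟨⟨hPm, hPr⟩, hPi⟩ := mem_irrs.1 hP
    rw [← Finset.sum_filter, ← Finset.mul_sum]
    have := lsum_dvd f χ N (P ^ j) (hPm.pow j)
    rw [this, natDegree_pow, hPr, lam_pow f χ hPm, mul_comm j r]
    split_ifs
    · ring
    · simp
  rw [hL, Finset.Nat.sum_antidiagonal_eq_sum_range_succ
    (fun a b => (if a = 0 then 0 else psumS f χ a) * lSum f χ b)]
  have hR : ∀ k ∈ Finset.range (N + 1), (if k = 0 then 0 else psumS f χ k) * lSum f χ (N - k) =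
      ∑ x ∈ Finset.Icc 1 N ×ˢ Finset.Icc 1 N, if x.1 * x.2 = k then
        (∑ P ∈ irrs K x.1, (x.1 : ℂ) * lam f χ P ^ x.2) * lSum f χ (N - k) else 0 := by
    intro k hk
    rw [Finset.mem_range] at hk
    have h0 : (if k = 0 then 0 else psumS f χ k) = psumS f χ k := by
      split_ifs with h
      · rw [h]; simp [psumS]
      · rfl
    rw [h0, psumS, Finset.sum_mul, ← Finset.sum_filter]
    refine Finset.sum_congr ?_ fun _ _ => rfl
    ext ⟨a, b⟩
    simp only [Nat.mem_divisorsAntidiagonal, Finset.mem_filter, Finset.mem_product, Finset.mem_Icc]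
    constructor
    · rintro ⟨h1, h2⟩
      have ha : a ≠ 0 := by rintro rfl; simp at h1; omega
      have hb : b ≠ 0 := by rintro rfl; simp at h1; omega
      have h3 : a ≤ a * b := Nat.le_mul_of_pos_right _ (by omega)
      have h4 : b ≤ a * b := Nat.le_mul_of_pos_left _ (by omega)
      omega
    · rintro ⟨⟨h1, h2⟩, h3⟩
      refine ⟨h3, ?_⟩
      rw [← h3]; exact Nat.mul_ne_zero (by omega) (by omega)
  rw [Finset.sum_congr rfl hR, Finset.sum_comm, Finset.sum_product]
  refine Finset.sum_congr rfl fun r hr => ?_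
  rw [Finset.sum_comm]
  refine Finset.sum_congr rfl fun j hj => ?_
  rw [Finset.sum_ite_eq]
  simp only [Finset.mem_range, Nat.lt_succ_iff]
  split_ifs with h
  · rw [Finset.sum_mul]
  · simp

end LFun

end PiecePF

section PiecePF3
open Polynomial

section LFun3
variable {K : Type*} [Field K] [Finite K]

theorem norm_eq_resultant {L : Type*} [Field L] [Algebra K L] [Finite L] (pb : PowerBasis K L)
    (f : K[X]) : Algebra.norm K (aeval pb.gen f) = resultant (minpoly K pb.gen) f := by
  classical
  have : FiniteDimensional K L := pb.finite
  apply (algebraMap K L).injective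
  have hIntegral : IsIntegral K pb.gen := pb.isIntegral_gen
  have hspl : ((minpoly K pb.gen).map (algebraMap K L)).Splits := Normal.splits inferInstance pb.gen
  have hroots : ((minpoly K pb.gen).map (algebraMap K L)).roots =
      (Finset.univ : Finset (Gal(L/K))).val.map (fun σ => σ pb.gen) := by
    symm
    apply Multiset.eq_of_le_of_card_le
    · rw [Multiset.le_iff_subset]
      · intro β hβ
        obtain ⟨σ, -, rfl⟩ := Multiset.mem_map.1 hβ
        rw [mem_roots ((minpoly.monic hIntegral).map _).ne_zero, IsRoot, eval_map_algebraMap]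
        have := minpoly.aeval K pb.gen
        have h2 := aeval_algHom_apply (σ : L →ₐ[K] L) pb.gen (minpoly K pb.gen)
        rw [this] at h2
        simpa using h2
      · refine (Multiset.nodup_map_iff_inj_on Finset.univ.nodup).2 ?_
        intro σ _ τ _ h
        have : (σ : L →ₐ[K] L) = τ := pb.algHom_ext h
        ext x
        exact DFunLike.congr_fun this x
    · refine (card_roots' _).trans ?_
      rw [natDegree_map, pb.natDegree_minpoly, ← pb.finrank, Multiset.card_map]
      rw [← IsGalois.card_aut_eq_finrank, Nat.card_eq_fintype_card]
      rfl
  rw [Algebra.norm_eq_prod_automorphisms, ← resultant_map_map]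
  have h3 := resultant_eq_prod_eval ((minpoly K pb.gen).map (algebraMap K L)) (f.map (algebraMap K L))
    f.natDegree (natDegree_map_le) hspl
  rw [natDegree_map, ((minpoly.monic hIntegral).map _).leadingCoeff, one_pow, one_mul, hroots,
    Multiset.map_map] at h3
  rw [h3]
  refine Finset.prod_congr rfl fun σ _ => ?_
  have h2 := aeval_algHom_apply (σ : L →ₐ[K] L) pb.gen f
  simp only [Function.comp, eval_map_algebraMap]
  exact h2.symm

theorem norm_aeval_eq {E : Type*} [Field E] [Algebra K E] [Finite E] (α : E) (f : K[X]) :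
    Algebra.norm K (aeval α f) =
      resultant (minpoly K α) f ^ (Module.finrank K E / (minpoly K α).natDegree) := by
  have : FiniteDimensional K E := Module.Finite.of_finite
  have hIntegral : IsIntegral K α := Algebra.IsIntegral.isIntegral α
  let pb := IntermediateField.adjoin.powerBasis hIntegral
  have hgen : algebraMap (IntermediateField.adjoin K {α}) E pb.gen = α := rfl
  have h1 : aeval α f = algebraMap (IntermediateField.adjoin K {α}) E (aeval pb.gen f) := by
    rw [← aeval_algebraMap_apply, hgen]
  rw [h1, ← Algebra.norm_norm (S := IntermediateField.adjoin K {α}), Algebra.norm_algebraMap, map_pow,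
    norm_eq_resultant]
  have h2 : minpoly K pb.gen = minpoly K α := by
    conv_rhs => rw [← hgen]
    exact (minpoly.algebraMap_eq (algebraMap (IntermediateField.adjoin K {α}) E).injective _).symm
  rw [h2]
  congr 1
  have h3 := Module.finrank_mul_finrank K (IntermediateField.adjoin K {α}) E
  rw [IntermediateField.adjoin.finrank hIntegral] at h3
  rw [← h3, Nat.mul_div_cancel_left _ (minpoly.natDegree_pos hIntegral)]

theorem card_minpoly_eq {E : Type*} [Field E] [Algebra K E] [Fintype E] [DecidableEq K[X]] (P : K[X]) (hP : P.Monic)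
    (hirr : Irreducible P) (hd : P.natDegree ∣ Module.finrank K E) :
    (Finset.univ.filter fun α : E => minpoly K α = P).card = P.natDegree := by
  classical
  have hdv := hirr.natDegree_dvd_iff_dvd_X_pow_card_pow_sub_X.1 hd
  rw [← Module.natCard_eq_pow_finrank, Nat.card_eq_fintype_card] at hdv
  have hspl : (P.map (algebraMap K E)).Splits := by
    refine Splits.of_dvd ?_ ?_ (map_dvd (algebraMap K E) hdv)
    · have := FiniteField.isSplittingField_sub (K := E) (F := K)
      exact this.splits
    · rw [Polynomial.map_ne_zero_iff (algebraMap K E).injective]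
      exact FiniteField.X_pow_card_sub_X_ne_zero K Fintype.one_lt_card
  have hsep : P.Separable := PerfectField.separable_of_irreducible hirr
  rw [← card_rootSet_eq_natDegree hsep hspl, ← Set.toFinset_card]
  congr 1
  ext α
  simp only [Finset.mem_filter, Finset.mem_univ, true_and, Set.mem_toFinset, mem_rootSet]
  constructor
  · rintro rfl
    exact ⟨hP.ne_zero, minpoly.aeval K α⟩
  · rintro ⟨-, h⟩
    exact (minpoly.eq_of_irreducible_of_monic hirr h hP).symm

theorem psumS_eq (f : K[X]) (χ : MulChar K ℂ) (E : Type*) [Field E] [Algebra K E] [Fintype E] :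
    psumS f χ (Module.finrank K E) = ∑ α : E, χ (Algebra.norm K (aeval α f)) := by
  classical
  have : FiniteDimensional K E := Module.Finite.of_finite
  set k := Module.finrank K E with hk
  have hk0 : 0 < k := Module.finrank_pos
  rw [psumS, Finset.sum_sigma']
  rw [← Finset.sum_fiberwise_of_maps_to (s := (Finset.univ : Finset E))
    (t := k.divisorsAntidiagonal.sigma fun x => irrs K x.1)
    (g := fun α => ⟨((minpoly K α).natDegree, k / (minpoly K α).natDegree), minpoly K α⟩)]
  · refine Finset.sum_congr rfl ?_
    rintro ⟨⟨r, j⟩, P⟩ hx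
    simp only [Finset.mem_sigma, Nat.mem_divisorsAntidiagonal, mem_irrs] at hx
    obtain ⟨⟨hrj, -⟩, ⟨hPm, rfl⟩, hPi⟩ := hx
    have hj : j = k / P.natDegree := by
      rw [← hrj, Nat.mul_div_cancel_left _ hPi.natDegree_pos]
    have hfil : (Finset.univ.filter fun α : E => (⟨((minpoly K α).natDegree, k / (minpoly K α).natDegree), minpoly K α⟩ : (_ : ℕ × ℕ) × K[X]) = ⟨(P.natDegree, j), P⟩)
        = Finset.univ.filter fun α : E => minpoly K α = P := by
      ext α
      simp only [Finset.mem_filter, Finset.mem_univ, true_and]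
      constructor
      · intro h; exact (Sigma.mk.inj_iff.1 h).2.eq
      · rintro rfl; rw [hj]
    rw [hfil]
    have hc : ∀ α ∈ Finset.univ.filter (fun α : E => minpoly K α = P),
        χ (Algebra.norm K (aeval α f)) = lam f χ P ^ j := by
      intro α hα
      have := (Finset.mem_filter.1 hα).2
      rw [norm_aeval_eq, this, map_pow, ← hk, ← hj, lam]
    rw [Finset.sum_congr rfl hc, Finset.sum_const, card_minpoly_eq P hPm hPi ⟨j, hrj.symm⟩]
    simp
  · intro α _
    have hIntegral : IsIntegral K α := Algebra.IsIntegral.isIntegral α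
    simp only [Finset.mem_sigma, Nat.mem_divisorsAntidiagonal, mem_irrs]
    exact ⟨⟨Nat.mul_div_cancel' (minpoly.degree_dvd hIntegral), hk0.ne'⟩,
      ⟨minpoly.monic hIntegral, trivial⟩, minpoly.irreducible hIntegral⟩

end LFun3

end PiecePF3

section PiecePF4
open Polynomial

section LFun4
variable (p : ℕ) [hpf : Fact p.Prime]

theorem stepanov_sum (hp : 5 ≤ p) (f P : (ZMod p)[X]) (hPm : P.Monic) (hPi : Irreducible P)
    (hPf : P ∣ f) (hPd : ¬ P ∣ derivative f) (χ : MulChar (ZMod p) ℂ) (hχ : χ ≠ 1)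
    (E : Type) [Field E] [Algebra (ZMod p) E] [Fintype E] (μ : ℕ) (hμ : 1 ≤ μ)
    (hr : P.natDegree ∣ 2 * μ) (hE : Module.finrank (ZMod p) E = 2 * μ) :
    ‖∑ α : E, χ (Algebra.norm (ZMod p) (aeval α f))‖ ≤
      (((p - 1) * (2 * f.natDegree + 4) + f.natDegree : ℕ) : ℝ) * (p : ℝ) ^ μ := by
  classical
  have hp1 := hpf.out
  have hf0 : f ≠ 0 := by rintro rfl; simp at hPd
  have : CharP E p := charP_of_injective_algebraMap (algebraMap (ZMod p) E).injective p
  have : FiniteDimensional (ZMod p) E := Module.Finite.of_finite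
  have hcard : Fintype.card E = (p ^ μ) ^ 2 := by
    rw [← Nat.card_eq_fintype_card, Module.natCard_eq_pow_finrank (K := ZMod p), hE, Nat.card_zmod, ← pow_mul,
      mul_comm]
  have hdvd : (p - 1) ∣ p ^ μ - 1 := by simpa using Nat.sub_dvd_pow_sub_pow p 1 μ
  obtain ⟨Q, hQ⟩ := hdvd
  have hpμ : p ≤ p ^ μ := Nat.le_self_pow (by omega) p
  have hP0 : p ^ μ = (p - 1) * Q + 1 := by omega
  have hQ1 : 1 ≤ Q := by
    rcases Nat.eq_zero_or_pos Q with h | h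
    · subst h; omega
    · exact h
  -- the simple root
  obtain ⟨x₀, hx₀⟩ : ∃ x₀ : E, minpoly (ZMod p) x₀ = P := by
    have := card_minpoly_eq (E := E) P hPm hPi (by rw [hE]; exact hr)
    have hpos : 0 < P.natDegree := hPi.natDegree_pos
    rw [← this, Finset.card_pos] at hpos
    obtain ⟨x, hx⟩ := hpos
    exact ⟨x, (Finset.mem_filter.1 hx).2⟩
  set g : E[X] := f.map (algebraMap (ZMod p) E) with hg
  have hroot : g.IsRoot x₀ := by
    rw [IsRoot, hg, eval_map_algebraMap, ← minpoly.dvd_iff, hx₀]; exact hPf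
  obtain ⟨h, hh⟩ := dvd_iff_isRoot.2 hroot
  have hhne : h.eval x₀ ≠ 0 := by
    intro h0
    apply hPd
    rw [← hx₀, minpoly.dvd_iff, ← eval_map_algebraMap, ← derivative_map, ← hg, hh]
    simp [h0]
  have hexp : (Nat.card E - 1) / (Nat.card (ZMod p) - 1) = Q * (p ^ μ + 1) := by
    rw [Nat.card_eq_fintype_card, hcard, Nat.card_zmod]
    apply Nat.div_eq_of_eq_mul_right (by omega)
    have : (p ^ μ) ^ 2 - 1 = (p ^ μ - 1) * (p ^ μ + 1) := by
      rw [mul_comm]; simpa using Nat.sq_sub_sq (p ^ μ) 1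
    rw [this, hQ, mul_assoc]
  set N : ZMod p → ℕ := fun t => (Finset.univ.filter fun α : E => Algebra.norm (ZMod p) (aeval α f) = t).card with hN
  set U : ℕ := p ^ μ * Q + (2 * f.natDegree + 4) * p ^ μ with hU
  have hNU : ∀ t : ZMod p, t ≠ 0 → N t ≤ U := by
    intro t ht
    obtain ⟨c, hc⟩ := FiniteField.norm_surjective (ZMod p) E t⁻¹
    have hc0 : c ≠ 0 := by
      rintro rfl
      rw [Algebra.norm_zero] at hc
      exact ht (inv_eq_zero.1 hc.symm)
    have hS := stepanov p μ (p ^ μ) (p - 1) Q f.natDegree rfl hcard hP0 (by omega) hQ1 g h x₀ c hh hhne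
      natDegree_map_le hc0
    refine le_trans (Finset.card_le_card ?_) hS
    intro α hα
    simp only [Finset.mem_filter, Finset.mem_univ, true_and] at hα ⊢
    rw [← hexp, ← FiniteField.algebraMap_norm_eq_pow, map_mul, hc, hg, eval_map_algebraMap, hα,
      inv_mul_cancel₀ ht, map_one]
  have hzero : N 0 ≤ f.natDegree := by
    have : Finset.univ.filter (fun α : E => Algebra.norm (ZMod p) (aeval α f) = 0) ⊆ g.roots.toFinset := by
      intro α hα
      simp only [Finset.mem_filter, Finset.mem_univ, true_and, Algebra.norm_eq_zero_iff] at hα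
      rw [Multiset.mem_toFinset, mem_roots, IsRoot, hg, eval_map_algebraMap, hα]
      rw [hg, Polynomial.map_ne_zero_iff (algebraMap (ZMod p) E).injective]; exact hf0
    refine (Finset.card_le_card this).trans ((Multiset.toFinset_card_le _).trans ((card_roots' _).trans ?_))
    exact natDegree_map_le
  have htot : ∑ t : ZMod p, N t = (p ^ μ) ^ 2 := by
    rw [← hcard, hN, ← Finset.card_univ]
    exact (Finset.card_eq_sum_card_fiberwise (fun _ _ => Finset.mem_univ _)).symm
  have hsum : ∑ α : E, χ (Algebra.norm (ZMod p) (aeval α f)) = ∑ t : ZMod p, (N t : ℂ) * χ t := by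
    rw [← Finset.sum_fiberwise (s := Finset.univ) (g := fun α : E => Algebra.norm (ZMod p) (aeval α f))]
    refine Finset.sum_congr rfl fun t _ => ?_
    rw [Finset.sum_congr rfl (g := fun _ => χ t), Finset.sum_const, nsmul_eq_mul]
    intro α hα
    rw [(Finset.mem_filter.1 hα).2]
  have hsum2 : ∑ t : ZMod p, (N t : ℂ) * χ t = ∑ t ∈ Finset.univ.erase (0 : ZMod p), ((N t : ℂ) - U) * χ t := by
    rw [Finset.sum_erase _ (by simp [MulChar.map_zero])]
    simp only [sub_mul, Finset.sum_sub_distrib, ← Finset.mul_sum]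
    rw [MulChar.sum_eq_zero_of_ne_one hχ]; simp
  rw [hsum, hsum2]
  refine (norm_sum_le _ _).trans ?_
  have hle : ∀ t ∈ Finset.univ.erase (0 : ZMod p), ‖((N t : ℂ) - U) * χ t‖ ≤ (U : ℝ) - N t := by
    intro t ht
    rw [norm_mul]
    have h1 : ‖χ t‖ ≤ 1 := DirichletCharacter.norm_le_one χ t
    have h2 : ‖(N t : ℂ) - U‖ = (U : ℝ) - N t := by
      have : (N t : ℝ) ≤ U := by exact_mod_cast hNU t (Finset.ne_of_mem_erase ht)
      rw [← norm_neg, neg_sub]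
      rw [show (U : ℂ) - N t = (((U : ℝ) - N t : ℝ) : ℂ) by push_cast; rfl, Complex.norm_real,
        Real.norm_of_nonneg (by linarith)]
    rw [h2]
    have h3 : 0 ≤ (U : ℝ) - N t := by rw [← h2]; positivity
    nlinarith
  refine (Finset.sum_le_sum hle).trans ?_
  rw [Finset.sum_sub_distrib, Finset.sum_const, Finset.card_erase_of_mem (Finset.mem_univ _),
    Finset.card_univ, ZMod.card, nsmul_eq_mul]
  have htot2 : ∑ t ∈ Finset.univ.erase (0 : ZMod p), (N t : ℝ) = ((p : ℝ) ^ μ) ^ 2 - N 0 := by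
    have := Finset.add_sum_erase Finset.univ (fun t => (N t : ℝ)) (Finset.mem_univ (0 : ZMod p))
    have h2 : (∑ t : ZMod p, (N t : ℝ)) = ((p : ℝ) ^ μ) ^ 2 := by exact_mod_cast htot
    linarith
  rw [htot2]
  have hz : (N 0 : ℝ) ≤ f.natDegree := by exact_mod_cast hzero
  have hP0' : ((p : ℝ) ^ μ) = ((p - 1 : ℕ) : ℝ) * Q + 1 := by exact_mod_cast hP0
  have hge : (1 : ℝ) ≤ (p : ℝ) ^ μ := by
    have : 1 ≤ p ^ μ := by omega
    exact_mod_cast this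
  have hUr : (U : ℝ) = (p : ℝ) ^ μ * Q + (2 * f.natDegree + 4) * (p : ℝ) ^ μ := by
    rw [hU]; push_cast; ring
  rw [hUr]
  push_cast
  set m : ℝ := (f.natDegree : ℝ) with hm
  have hm0 : 0 ≤ m := by positivity
  set T := (p : ℝ) ^ μ
  set D : ℝ := ((p - 1 : ℕ) : ℝ)
  have : D * (T * Q + (2 * m + 4) * T) = T * (T - 1) + D * (2 * m + 4) * T := by rw [hP0']; ring
  rw [this]
  nlinarith

theorem trivial_sum (f : (ZMod p)[X]) (hf0 : f ≠ 0) (χ : MulChar (ZMod p) ℂ)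
    (hcon : ∀ u : (ZMod p)[X], u.Monic → IsCoprime u f → lam f χ u = χ (ctw f) ^ u.natDegree)
    (E : Type) [Field E] [Algebra (ZMod p) E] [Fintype E] :
    (Fintype.card E : ℝ) ≤ ‖∑ α : E, χ (Algebra.norm (ZMod p) (aeval α f))‖ + f.natDegree := by
  classical
  have : FiniteDimensional (ZMod p) E := Module.Finite.of_finite
  set k := Module.finrank (ZMod p) E with hk
  have hval : ∀ α : E, aeval α f ≠ 0 →
      χ (Algebra.norm (ZMod p) (aeval α f)) = χ (ctw f) ^ k := by
    intro α hα
    have hIntegral : IsIntegral (ZMod p) α := Algebra.IsIntegral.isIntegral α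
    have hc := hcon (minpoly (ZMod p) α) (minpoly.monic hIntegral)
      ((minpoly.irreducible hIntegral).coprime_iff_not_dvd.2 (by rwa [minpoly.dvd_iff]))
    rw [norm_aeval_eq, map_pow, ← lam, hc, ← pow_mul]
    congr 1
    exact Nat.mul_div_cancel' (minpoly.degree_dvd hIntegral)
  have hctw : ctw f ≠ 0 := by
    rw [ctw]; exact mul_ne_zero (pow_ne_zero _ (by simp)) (leadingCoeff_ne_zero.2 hf0)
  have hnorm : ‖χ (ctw f) ^ k‖ = 1 := by
    rw [norm_pow, show ctw f = ((Units.mk0 _ hctw : (ZMod p)ˣ) : ZMod p) from rfl,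
      DirichletCharacter.unit_norm_eq_one, one_pow]
  have hS : ∑ α : E, χ (Algebra.norm (ZMod p) (aeval α f)) =
      ((Finset.univ.filter fun α : E => aeval α f ≠ 0).card : ℂ) * χ (ctw f) ^ k := by
    rw [← Finset.sum_filter_add_sum_filter_not Finset.univ (fun α : E => aeval α f ≠ 0)]
    rw [Finset.sum_congr rfl (g := fun _ => χ (ctw f) ^ k) (fun α hα => hval α (Finset.mem_filter.1 hα).2)]
    rw [Finset.sum_eq_zero (s := Finset.univ.filter fun α : E => ¬ (aeval α f ≠ 0))]
    · simp
    · intro α hα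
      have := (Finset.mem_filter.1 hα).2
      rw [not_not.1 this, Algebra.norm_zero, MulChar.map_zero]
  rw [hS, norm_mul, hnorm, mul_one]
  simp only [RCLike.norm_natCast]
  have hzero : (Finset.univ.filter fun α : E => ¬ (aeval α f ≠ 0)).card ≤ f.natDegree := by
    have : (Finset.univ.filter fun α : E => ¬ (aeval α f ≠ 0)) ⊆
        (f.map (algebraMap (ZMod p) E)).roots.toFinset := by
      intro α hα
      simp only [Finset.mem_filter, Finset.mem_univ, true_and, not_not] at hα
      rw [Multiset.mem_toFinset, mem_roots, IsRoot, eval_map_algebraMap, hα]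
      rw [Polynomial.map_ne_zero_iff (algebraMap (ZMod p) _).injective]; exact hf0
    refine (Finset.card_le_card this).trans ((Multiset.toFinset_card_le _).trans ((card_roots' _).trans ?_))
    exact natDegree_map_le
  have hsplit := Finset.card_filter_add_card_filter_not (s := (Finset.univ : Finset E))
    (fun α : E => aeval α f ≠ 0)
  rw [Finset.card_univ] at hsplit
  rw [← hsplit]
  push_cast
  have : ((Finset.univ.filter fun α : E => ¬ (aeval α f ≠ 0)).card : ℝ) ≤ f.natDegree := by
    exact_mod_cast hzero
  linarith

theorem weil_bound (hp : 5 ≤ p) (f P : (ZMod p)[X]) (hPm : P.Monic) (hPi : Irreducible P)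
    (hPf : P ∣ f) (hPd : ¬ P ∣ derivative f) (χ : MulChar (ZMod p) ℂ) (hχ : χ ≠ 1)
    (E : Type) [Field E] [Algebra (ZMod p) E] [Fintype E] :
    ‖∑ α : E, χ (Algebra.norm (ZMod p) (aeval α f))‖ ≤
      (f.natDegree : ℝ) * Real.sqrt (Fintype.card E) := by
  classical
  have hf0 : f ≠ 0 := by rintro rfl; simp at hPd
  have hp1 := hpf.out
  have hrpos := hPi.natDegree_pos
  set r := P.natDegree with hr
  set C0 : ℕ := (p - 1) * (2 * f.natDegree + 4) + f.natDegree with hC0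
  have hf1 : 1 ≤ f.natDegree := hrpos.trans_le (natDegree_le_of_dvd hPf hf0)
  have key : ∀ n : ℕ, 1 ≤ n → ‖psumS f χ (2 * (r * n))‖ ≤ (C0 : ℝ) * (p : ℝ) ^ (r * n) := by
    intro n hn
    have hrn : 1 ≤ r * n := Nat.mul_pos hrpos hn
    have : Fintype (GaloisField p (2 * (r * n))) := Fintype.ofFinite _
    have hfr := GaloisField.finrank p (n := 2 * (r * n)) (by omega)
    have := stepanov_sum p hp f P hPm hPi hPf hPd χ hχ (GaloisField p (2 * (r * n))) (r * n) hrn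
      (by rw [← hr]; exact ⟨2 * n, by ring⟩) hfr
    rw [← psumS_eq, hfr] at this
    exact this
  have hex : ∃ u : (ZMod p)[X], u.Monic ∧ IsCoprime u f ∧ lam f χ u ≠ χ (ctw f) ^ u.natDegree := by
    by_contra hcon
    push Not at hcon
    set n := C0 + f.natDegree + 1 with hn
    set k := 2 * (r * n) with hk
    have hn1 : 1 ≤ n := by omega
    have hrn : 1 ≤ r * n := Nat.mul_pos hrpos hn1
    have hb := key n hn1
    have : Fintype (GaloisField p k) := Fintype.ofFinite _
    have hfr : Module.finrank (ZMod p) (GaloisField p k) = k := GaloisField.finrank p (by omega)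
    have hps := psumS_eq f χ (GaloisField p k)
    rw [hfr] at hps
    have ht := trivial_sum p f hf0 χ hcon (GaloisField p k)
    rw [← hps, ← Nat.card_eq_fintype_card, GaloisField.card p k (by omega)] at ht
    have hb3 : ((p ^ k : ℕ) : ℝ) ≤ (C0 : ℝ) * (p : ℝ) ^ (r * n) + f.natDegree := by
      linarith
    have hb2 : p ^ k ≤ C0 * p ^ (r * n) + f.natDegree := by exact_mod_cast hb3
    have hk2 : p ^ k = (p ^ (r * n)) ^ 2 := by rw [hk, ← pow_mul]; ring
    rw [hk2] at hb2
    have hbig : C0 + f.natDegree + 1 ≤ p ^ (r * n) := by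
      have h1 : r * n < p ^ (r * n) := Nat.lt_pow_self hp1.one_lt
      have h2 : n ≤ r * n := Nat.le_mul_of_pos_left _ hrpos
      omega
    nlinarith
  obtain ⟨u, hu, hcop, hne⟩ := hex
  obtain ⟨n, z, hn, hz⟩ := newton_roots f.natDegree (lSum f χ) (psumS f χ) (lsum_zero f χ)
    (fun N hN => lsum_eq_zero f χ hf0 u hu hcop hne N hN hf1) (lsum_rec f χ)
  have hp0 : (0 : ℝ) < p := by exact_mod_cast hp1.pos
  have hzb : ∀ i, ‖z i‖ ≤ Real.sqrt p := by
    intro i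
    refine powersum_bound' z (Real.sqrt p) C0 (Real.sqrt_pos.2 hp0) 1 (2 * r) (by omega) ?_ i
    intro n hn
    have h1 := key n hn
    rw [← mul_assoc] at h1
    rw [hz _ (Nat.mul_pos (by omega) hn), norm_neg] at h1
    refine h1.trans (le_of_eq ?_)
    rw [mul_assoc 2 r n, pow_mul (Real.sqrt p), Real.sq_sqrt hp0.le]
  have : FiniteDimensional (ZMod p) E := Module.Finite.of_finite
  rw [← psumS_eq, hz _ Module.finrank_pos, norm_neg]
  refine (norm_sum_le _ _).trans ?_
  have hcardE : (Fintype.card E : ℝ) = (p : ℝ) ^ Module.finrank (ZMod p) E := by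
    rw [← Nat.card_eq_fintype_card, Module.natCard_eq_pow_finrank (K := ZMod p), Nat.card_zmod]; push_cast; rfl
  have hsq : Real.sqrt (Fintype.card E) = Real.sqrt p ^ Module.finrank (ZMod p) E := by
    rw [hcardE]
    rw [Real.sqrt_eq_iff_eq_sq (by positivity) (by positivity), ← pow_mul, mul_comm, pow_mul, Real.sq_sqrt hp0.le]
  rw [hsq]
  calc ∑ i, ‖z i ^ Module.finrank (ZMod p) E‖ ≤ ∑ i : Fin n, Real.sqrt p ^ Module.finrank (ZMod p) E := by
        refine Finset.sum_le_sum fun i _ => ?_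
        rw [norm_pow]
        exact pow_le_pow_left₀ (norm_nonneg _) (hzb i) _
    _ = n * Real.sqrt p ^ Module.finrank (ZMod p) E := by simp
    _ ≤ _ := by
        gcongr

end LFun4

end PiecePF4

section PiecePD
open Polynomial

theorem sum_eval_eq_neg_coeff {F : Type*} [Field F] [Fintype F] (g : F[X])
    (hg : g.natDegree < 2 * (Fintype.card F - 1)) :
    ∑ x : F, g.eval x = - g.coeff (Fintype.card F - 1) := by
  classical
  have hq : 1 < Fintype.card F := Fintype.one_lt_card
  simp only [fun x : F => eval_eq_sum_range' hg x]
  rw [Finset.sum_comm, Finset.sum_eq_single (Fintype.card F - 1)]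
  · rw [← Finset.mul_sum]
    have : ∑ x : F, x ^ (Fintype.card F - 1) = -1 := by
      rw [← Finset.add_sum_erase _ _ (Finset.mem_univ (0 : F)), zero_pow (by omega), zero_add]
      rw [Finset.sum_congr rfl (g := fun _ => (1 : F))
        (fun x hx => FiniteField.pow_card_sub_one_eq_one x (Finset.ne_of_mem_erase hx))]
      rw [Finset.sum_const, Finset.card_erase_of_mem (Finset.mem_univ _), Finset.card_univ,
        nsmul_eq_mul, Nat.cast_sub hq.le, FiniteField.cast_card_eq_zero]
      simp
    rw [this]; ring
  · intro i hi hne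
    rw [← Finset.mul_sum]
    rw [Finset.mem_range] at hi
    rcases lt_or_gt_of_ne hne with h | h
    · rw [FiniteField.sum_pow_lt_card_sub_one F i h, mul_zero]
    · have : ∀ x : F, x ^ i = x ^ (i - (Fintype.card F - 1)) := by
        intro x
        by_cases hx : x = 0
        · subst hx; rw [zero_pow (by omega), zero_pow (by omega)]
        · conv_lhs => rw [show i = (i - (Fintype.card F - 1)) + (Fintype.card F - 1) by omega]
          rw [pow_add, FiniteField.pow_card_sub_one_eq_one x hx, mul_one]
      simp only [this]
      rw [FiniteField.sum_pow_lt_card_sub_one F _ (by omega), mul_zero]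
  · intro h; simp at h; omega

section SimpleRoot

/-- integer coefficients of the dehomogenized Hasse invariant -/
def hb (n N : ℕ) : ℕ := if n ≤ 3 * N then n.choose N * N.choose (3 * N - n) else 0

theorem hb_zero_of_lt {n N : ℕ} (h : n < 2 * N) : hb n N = 0 := by
  rw [hb]
  split_ifs with h1
  · rw [Nat.choose_eq_zero_of_lt (show N < 3 * N - n by omega), mul_zero]
  · rfl

theorem hb_rec (n N : ℕ) : (hb n N : ℤ) * (n - N) * (n - 2 * N - 1) * (n - 2 * N) =
    (hb n (N + 1) : ℤ) * (3 * N + 3 - n) * (3 * N + 2 - n) * (3 * N + 1 - n) := by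
  rcases lt_or_ge (3 * N) n with h1 | h1
  · have e1 : hb n N = 0 := by rw [hb, if_neg (by omega)]
    rw [e1]
    rcases lt_or_ge (3 * (N + 1)) n with h2 | h2
    · have e2 : hb n (N + 1) = 0 := by rw [hb, if_neg (by omega)]
      rw [e2]; simp
    · have : n = 3 * N + 1 ∨ n = 3 * N + 2 ∨ n = 3 * N + 3 := by omega
      rcases this with rfl | rfl | rfl <;> push_cast <;> ring
  rcases lt_or_ge n (2 * (N + 1)) with h2 | h2
  · rw [hb_zero_of_lt h2]
    rcases lt_or_ge n (2 * N) with h3 | h3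
    · rw [hb_zero_of_lt h3]; simp
    · have : n = 2 * N ∨ n = 2 * N + 1 := by omega
      rcases this with rfl | rfl <;> push_cast <;> ring
  · obtain ⟨j, hj⟩ := Nat.exists_eq_add_of_le h1
    obtain ⟨l, hl⟩ := Nat.exists_eq_add_of_le h2
    have hN : N = j + l + 2 := by omega
    have hn : n = 2 * j + 3 * l + 6 := by omega
    subst hN
    have e1 : hb n (j + l + 2) = n.choose (j + l + 2) * (j + l + 2).choose j := by
      rw [hb, if_pos (by omega)]; congr 2; omega
    have e2 : hb n (j + l + 2 + 1) = n.choose (j + l + 2 + 1) * (j + l + 3).choose (j + 3) := by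
      rw [hb, if_pos (by omega)]; congr 2; omega
    have c1 := Nat.choose_succ_right_eq n (j + l + 2)
    have c2 : (j + l + 2).choose j * ((l + 2) * (l + 1)) * (j + l + 3) =
        (j + l + 3).choose (j + 3) * ((j + 3) * (j + 2) * (j + 1)) := by
      have f1 := Nat.add_choose_mul_factorial_mul_factorial j (l + 2)
      have f2 := Nat.add_choose_mul_factorial_mul_factorial (j + 3) l
      have f3 : j + 3 + l = j + l + 3 := by omega
      rw [f3] at f2
      rw [← add_assoc] at f1
      have g1 : (l + 2).factorial = (l + 2) * ((l + 1) * l.factorial) := rfl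
      have g2 : (j + 3).factorial = (j + 3) * ((j + 2) * ((j + 1) * j.factorial)) := rfl
      have g3 : (j + l + 3).factorial = (j + l + 3) * (j + l + 2).factorial := rfl
      rw [g1] at f1
      rw [g2, g3, ← f1] at f2
      have hpos : 0 < j.factorial * l.factorial := Nat.mul_pos (Nat.factorial_pos _) (Nat.factorial_pos _)
      apply Nat.eq_of_mul_eq_mul_right hpos
      have s1 : (j + l + 2).choose j = (j + l + 2).choose (l + 2) := Nat.choose_symm_add (a := j) (b := l + 2)
      have s2 : (j + 3 + l).choose (j + 3) = (j + 3 + l).choose l := Nat.choose_symm_add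
      rw [f3] at s2
      rw [s1, s2]
      linarith [f2]
    have c1' : (n.choose (j + l + 2 + 1) : ℤ) * (j + l + 3) = n.choose (j + l + 2) * (j + 2 * l + 4) := by
      have : n - (j + l + 2) = j + 2 * l + 4 := by omega
      rw [this] at c1
      exact_mod_cast c1
    have c2' : ((j + l + 2).choose j : ℤ) * ((l + 2) * (l + 1)) * (j + l + 3) =
        (j + l + 3).choose (j + 3) * ((j + 3) * (j + 2) * (j + 1)) := by exact_mod_cast c2
    rw [e1, e2]
    have hn' : (n : ℤ) = 2 * j + 3 * l + 6 := by exact_mod_cast hn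
    generalize n.choose (j + l + 2 + 1) = x at *
    generalize n.choose (j + l + 2) = y at *
    generalize (j + l + 2).choose j = u at *
    generalize (j + l + 3).choose (j + 3) = v at *
    rw [hn']
    push_cast
    have h3 : ((j : ℤ) + l + 3) ≠ 0 := by positivity
    apply mul_right_cancel₀ h3
    linear_combination (-(u : ℤ) * ((l + 2) * (l + 1)) * (j + l + 3)) * c1' + (x : ℤ) * (j + l + 3) * c2'

variable (p n : ℕ) [hpf : Fact p.Prime]

noncomputable def hf : (ZMod p)[X] := ∑ N ∈ Finset.range (n + 1), C (hb n N : ZMod p) * X ^ N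

theorem hf_coeff (N : ℕ) : (hf p n).coeff N = (hb n N : ZMod p) := by
  rw [hf, finsetSum_coeff]
  simp only [coeff_C_mul_X_pow]
  rw [Finset.sum_ite_eq]
  split_ifs with h
  · rfl
  · rw [hb_zero_of_lt (by simp at h; omega)]; simp

theorem hf_natDegree : 2 * (hf p n).natDegree ≤ n := by
  by_contra h
  have h1 : (hf p n).natDegree ≤ n / 2 := by
    rw [natDegree_le_iff_coeff_eq_zero]
    intro N hN
    rw [hf_coeff, hb_zero_of_lt (by omega)]; simp
  omega

theorem hb_ne (hpn : p = 2 * n + 1) {N : ℕ} (h1 : n ≤ 3 * N) (h2 : 2 * N ≤ n) : (hb n N : ZMod p) ≠ 0 := by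
  have key : ∀ a b : ℕ, a ≤ n → b ≤ a → ¬ p ∣ a.choose b := by
    intro a b ha hb hd
    have : p ∣ a.factorial := by
      rw [← Nat.choose_mul_factorial_mul_factorial hb, mul_assoc]
      exact Dvd.dvd.mul_right hd _
    rw [hpf.out.dvd_factorial] at this
    omega
  rw [hb, if_pos h1, Ne, ZMod.natCast_eq_zero_iff, hpf.out.dvd_mul]
  push Not
  exact ⟨key _ _ le_rfl (by omega), key _ _ (by omega) (by omega)⟩

theorem hb_rec_mod (hpn : p = 2 * n + 1) (N : ℕ) :
    (4 * (N : ZMod p) + 1) * (4 * N + 3) * (hb n N : ZMod p) +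
      3 * (6 * N + 5) * (6 * N + 7) * (hb n (N + 1) : ZMod p) = 0 := by
  rcases lt_or_ge n (2 * N) with h | h
  · rw [hb_zero_of_lt h, hb_zero_of_lt (show n < 2 * (N + 1) by omega)]; simp
  have h1 : (2 * n : ZMod p) = -1 := by
    have : ((2 * n + 1 : ℕ) : ZMod p) = 0 := by rw [← hpn]; simp
    push_cast at this
    linear_combination this
  have h2 := congrArg (Int.cast : ℤ → ZMod p) (hb_rec n N)
  push_cast at h2
  have h3 : (2 * (N : ZMod p) + 1) ≠ 0 := by
    have : ((2 * N + 1 : ℕ) : ZMod p) ≠ 0 := by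
      rw [Ne, ZMod.natCast_eq_zero_iff]
      intro hd
      have := Nat.le_of_dvd (by omega) hd
      have := hpf.out.one_lt
      omega
    push_cast at this; exact this
  apply mul_left_cancel₀ h3
  rw [mul_zero]
  generalize (hb n N : ZMod p) = x at *
  generalize (hb n (N + 1) : ZMod p) = y at *
  generalize (N : ZMod p) = N at *
  have e1 : (2 * (n : ZMod p) - 2 * N) * (2 * n - 4 * N - 2) * (2 * n - 4 * N) * x
    = y * (6 * N + 6 - 2 * n) * (6 * N + 4 - 2 * n) * (6 * N + 2 - 2 * n) := by
    linear_combination 8 * h2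
  rw [h1] at e1
  linear_combination -e1

theorem hf_ode (hpn : p = 2 * n + 1) :
    (16 * X + 108) * X ^ 2 * derivative (derivative (hf p n)) +
      (32 * X ^ 2 + 108 * X) * derivative (hf p n) + (3 * X - 3) * hf p n = 0 := by
  have th : ∀ (g : (ZMod p)[X]) (N : ℕ), (X * derivative g).coeff N = N * g.coeff N := by
    intro g N
    cases N with
    | zero => simp
    | succ N => rw [coeff_X_mul, coeff_derivative]; push_cast; ring
  set f := hf p n with hfdef
  have : X * (C 16 * (X * derivative (X * derivative f)) + C 16 * (X * derivative f) + C 3 * f) +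
      (C 108 * (X * derivative (X * derivative f)) - C 3 * f) = 0 := by
    ext N
    cases N with
    | zero =>
      simp only [coeff_add, coeff_sub, coeff_C_mul, th, coeff_zero]
      simp [hfdef, hf_coeff]
      right
      rw [hb]; split_ifs with h2
      · simp at h2
        subst h2
        have := hpf.out.one_lt
        omega
      · simp
    | succ N =>
      rw [coeff_add, coeff_X_mul]
      simp only [coeff_add, coeff_sub, coeff_C_mul, th, coeff_zero]
      simp only [hfdef, hf_coeff]
      have := hb_rec_mod p n hpn N
      push_cast
      linear_combination this
  have e16 : (C 16 : (ZMod p)[X]) = 16 := rfl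
  have e3 : (C 3 : (ZMod p)[X]) = 3 := rfl
  have e108 : (C 108 : (ZMod p)[X]) = 108 := rfl
  rw [e16, e3, e108] at this
  simp only [derivative_mul, derivative_X, one_mul] at this
  linear_combination this

end SimpleRoot

end PiecePD

section PiecePD2
open Polynomial

section SimpleRoot2
variable (p n : ℕ) [hpf : Fact p.Prime]

theorem hf_aeval {F : Type*} [Field F] [Algebra (ZMod p) F] (a : F) :
    aeval a (hf p n) = ((X ^ 3 + C a * X + C a : F[X]) ^ n).coeff (2 * n) := by
  have h1 : (X ^ 3 + C a * X + C a : F[X]) = C a * (X + 1) + X ^ 3 := by ring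
  rw [h1, add_pow, finsetSum_coeff, hf, map_sum]
  refine Finset.sum_congr rfl fun N hN => ?_
  have hN' : N ≤ n := by simp at hN; omega
  rw [map_mul, aeval_C, map_pow, aeval_X, map_natCast]
  have h2 : ((C a * (X + 1)) ^ N * (X ^ 3) ^ (n - N) * (n.choose N : F[X])) =
      C (a ^ N * (n.choose N : F)) * ((X + 1) ^ N * X ^ (3 * (n - N))) := by
    rw [mul_pow, ← pow_mul, C_mul, C_pow, ← C_eq_natCast]; ring
  rw [h2, coeff_C_mul, coeff_mul_X_pow', hb]
  by_cases h3 : n ≤ 3 * N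
  · rw [if_pos h3, if_pos (by omega), coeff_X_add_one_pow]
    have : 2 * n - 3 * (n - N) = 3 * N - n := by omega
    rw [this]; push_cast; ring
  · rw [if_neg h3, if_neg (by omega)]; simp

theorem hf_eval_ne (hp5 : 5 ≤ p) (hpn : p = 2 * n + 1) : (hf p n).eval (-27 / 4) ≠ 0 := by
  have h2 : (2 : ZMod p) ≠ 0 := by
    have : ((2 : ℕ) : ZMod p) ≠ 0 := by
      rw [Ne, ZMod.natCast_eq_zero_iff]; intro h; have := Nat.le_of_dvd (by omega) h; omega
    exact_mod_cast this
  have h3 : (3 : ZMod p) ≠ 0 := by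
    have : ((3 : ℕ) : ZMod p) ≠ 0 := by
      rw [Ne, ZMod.natCast_eq_zero_iff]; intro h; have := Nat.le_of_dvd (by omega) h; omega
    exact_mod_cast this
  have h4 : (4 : ZMod p) ≠ 0 := by
    rw [show (4 : ZMod p) = 2 * 2 by norm_num]; exact mul_ne_zero h2 h2
  have e := hf_aeval p n (-27 / 4 : ZMod p)
  rw [← coe_aeval_eq_eval, e]
  set α : ZMod p := -3 / 2 with hα
  have hfac : (X ^ 3 + C (-27 / 4 : ZMod p) * X + C (-27 / 4) : (ZMod p)[X]) =
      (X - C α) ^ 2 * (X + C (2 * α)) := by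
    have e1 : (-27 / 4 : ZMod p) = -3 * α ^ 2 := by rw [hα]; field_simp; norm_num
    have e2 : (-27 / 4 : ZMod p) = 2 * α ^ 3 := by rw [hα]; field_simp; norm_num
    conv_lhs => rw [e1]
    conv_lhs => enter [2]; rw [← e1, e2]
    simp only [C_mul, C_neg, C_pow]
    have c2 : (C 2 : (ZMod p)[X]) = 2 := rfl
    have c3 : (C 3 : (ZMod p)[X]) = 3 := rfl
    rw [c2, c3]; ring
  rw [hfac]
  have hcard : Fintype.card (ZMod p) = 2 * n + 1 := by rw [ZMod.card, hpn]
  have hs := sum_eval_eq_neg_coeff (((X - C α) ^ 2 * (X + C (2 * α))) ^ n) (by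
    rw [hcard]
    refine lt_of_le_of_lt natDegree_pow_le ?_
    have : ((X - C α) ^ 2 * (X + C (2 * α))).natDegree ≤ 3 := by compute_degree
    have : n * ((X - C α) ^ 2 * (X + C (2 * α))).natDegree ≤ n * 3 := Nat.mul_le_mul_left _ this
    omega)
  rw [hcard, Nat.add_sub_cancel] at hs
  have hs2 := sum_eval_eq_neg_coeff ((X + C (2 * α)) ^ n) (by
    rw [hcard]
    refine lt_of_le_of_lt natDegree_pow_le ?_
    rw [natDegree_X_add_C]
    omega)
  rw [hcard, Nat.add_sub_cancel, coeff_eq_zero_of_natDegree_lt, neg_zero] at hs2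
  swap
  · refine lt_of_le_of_lt natDegree_pow_le ?_
    rw [natDegree_X_add_C]
    omega
  classical
  have hs3 : ∑ x : ZMod p, eval x (((X - C α) ^ 2 * (X + C (2 * α))) ^ n) =
      ∑ x : ZMod p, eval x ((X + C (2 * α)) ^ n) - (3 * α) ^ n := by
    rw [← Finset.add_sum_erase _ _ (Finset.mem_univ α),
      ← Finset.add_sum_erase _ (fun x => eval x ((X + C (2 * α)) ^ n)) (Finset.mem_univ α)]
    have e1 : eval α (((X - C α) ^ 2 * (X + C (2 * α))) ^ n) = 0 := by
      simp; omega
    have e2 : eval α ((X + C (2 * α)) ^ n) = (3 * α) ^ n := by simp; ring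
    rw [e1, e2, zero_add, add_sub_cancel_left]
    refine Finset.sum_congr rfl fun x hx => ?_
    have hx' := sub_ne_zero.2 (Finset.ne_of_mem_erase hx)
    simp only [eval_pow, eval_mul, eval_sub, eval_add, eval_X, eval_C]
    rw [mul_pow, ← pow_mul]
    have := FiniteField.pow_card_sub_one_eq_one _ hx'
    rw [hcard, Nat.add_sub_cancel] at this
    rw [this, one_mul]
  rw [hs, hs2] at hs3
  intro h0
  rw [h0] at hs3
  have h5 : (3 * α) ^ n ≠ 0 := pow_ne_zero _ (mul_ne_zero h3 (div_ne_zero (neg_ne_zero.2 h3) h2))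
  apply h5
  linear_combination hs3

theorem hf_simple (hp13 : 13 ≤ p) (hpn : p = 2 * n + 1) :
    ∃ P : (ZMod p)[X], P.Monic ∧ Irreducible P ∧ P ∣ hf p n ∧ ¬ P ∣ derivative (hf p n) := by
  have hp1 := hpf.out
  have hode := hf_ode p n hpn
  have hdeg := hf_natDegree p n
  obtain ⟨N₀, hN1, hN2⟩ : ∃ N, n ≤ 3 * N ∧ 2 * (N + 1) ≤ n := by
    have h7 : n ≠ 7 := by
      rintro rfl
      rw [hpn] at hp1; norm_num at hp1
    refine ⟨(n + 2) / 3, by omega, by omega⟩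
  have hc1 : (hf p n).coeff N₀ ≠ 0 := by rw [hf_coeff]; exact hb_ne p n hpn hN1 (by omega)
  have hc2 : (hf p n).coeff (N₀ + 1) ≠ 0 := by rw [hf_coeff]; exact hb_ne p n hpn (by omega) hN2
  have hev := hf_eval_ne p n (by omega) hpn
  set f := hf p n with hfd
  have hf0 : f ≠ 0 := by rintro h; rw [h] at hc1; simp at hc1
  obtain ⟨g, hg, hXg⟩ := (FiniteMultiplicity.of_prime_left (prime_X (R := ZMod p)) hf0).exists_eq_pow_mul_and_not_dvd
  set e := multiplicity X f
  have hgu : ¬ IsUnit g := by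
    intro hu
    obtain ⟨c, -, rfl⟩ := Polynomial.isUnit_iff.1 hu
    rw [hg, coeff_mul_C, coeff_X_pow] at hc1 hc2
    split_ifs at hc1 hc2
    · omega
    · simp at hc2
    · simp at hc1
    · simp at hc1
  obtain ⟨P, hPm, hPi, hPg⟩ := exists_monic_irreducible_factor g hgu
  have hPf : P ∣ f := by rw [hg]; exact Dvd.dvd.mul_left hPg _
  refine ⟨P, hPm, hPi, hPf, ?_⟩
  have hPprime : Prime P := hPi.prime
  have hPX : ¬ P ∣ X := by
    intro h
    have := (hPi.associated_of_dvd irreducible_X h)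
    exact hXg (this.symm.dvd.trans hPg)
  have hnat : ∀ s : ℕ, s ≠ 0 → s < p → ¬ P ∣ (s : (ZMod p)[X]) := by
    intro s hs hsp h
    apply hPi.not_isUnit
    refine isUnit_of_dvd_unit h ?_
    rw [← C_eq_natCast, isUnit_C, isUnit_iff_ne_zero, Ne, ZMod.natCast_eq_zero_iff]
    intro hd
    have := Nat.le_of_dvd (by omega) hd
    omega
  have hP27 : ¬ P ∣ (16 * X + 108) := by
    intro h
    have h4 : (4 : ZMod p) ≠ 0 := by
      have : ((4 : ℕ) : ZMod p) ≠ 0 := by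
        rw [Ne, ZMod.natCast_eq_zero_iff]; intro h; have := Nat.le_of_dvd (by omega) h; omega
      exact_mod_cast this
    have e16 : (16 * X + 108 : (ZMod p)[X]) = C 16 * (X - C (-27 / 4)) := by
      rw [mul_sub, ← C_mul, show (16 : ZMod p) * (-27 / 4) = -108 by field_simp; norm_num]
      rw [C_neg, sub_neg_eq_add]; rfl
    rw [e16] at h
    have h16 : IsUnit (C 16 : (ZMod p)[X]) := by
      rw [isUnit_C, isUnit_iff_ne_zero, show (16 : ZMod p) = 4 * 4 by norm_num]; exact mul_ne_zero h4 h4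
    have h5 := (h16.dvd_mul_left).1 h
    have h6 := hPi.associated_of_dvd (irreducible_X_sub_C _) h5
    have h7 : (X - C (-27 / 4)) ∣ f := h6.symm.dvd.trans hPf
    rw [dvd_iff_isRoot] at h7
    exact hev h7
  have hPd : ¬ P ∣ derivative P := by
    have hsep : P.Separable := PerfectField.separable_of_irreducible hPi
    exact fun h => hPi.coprime_iff_not_dvd.1 hsep h
  intro hdv
  obtain ⟨h, hh, hPh⟩ := (FiniteMultiplicity.of_prime_left hPprime hf0).exists_eq_pow_mul_and_not_dvd
  set r := multiplicity P f
  have hr0 : r ≠ 0 := by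
    intro h0; rw [h0, pow_zero, one_mul] at hh; exact hPh (hh ▸ hPf)
  have hr1 : r ≠ 1 := by
    intro h1
    rw [h1, pow_one] at hh
    rw [hh, derivative_mul] at hdv
    have := (dvd_add_left (dvd_mul_right P (derivative h))).1 hdv
    rcases hPprime.dvd_or_dvd this with h | h
    · exact hPd h
    · exact hPh h
  obtain ⟨s, hs⟩ : ∃ s, r = s + 2 := ⟨r - 2, by omega⟩
  have hsp : s + 2 < p := by
    have h1 : P ^ (s + 2) ∣ f := by rw [hh, hs]; exact dvd_mul_right _ _
    have h2 := natDegree_le_of_dvd h1 hf0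
    rw [natDegree_pow] at h2
    have := hPi.natDegree_pos
    nlinarith
  rw [hs] at hh
  set u : (ZMod p)[X] := ((s + 2 : ℕ) : (ZMod p)[X]) * derivative P * h + P * derivative h with hu
  have hf1 : derivative f = P ^ (s + 1) * u := by
    rw [hh, derivative_mul, derivative_pow, hu]
    simp only [map_natCast, Nat.add_sub_cancel, show s + 2 - 1 = s + 1 by omega]
    ring
  have hf2 : derivative (derivative f) = P ^ s * (((s + 1 : ℕ) : (ZMod p)[X]) * derivative P * u + P * derivative u) := by
    rw [hf1, derivative_mul, derivative_pow]
    simp only [map_natCast, Nat.add_sub_cancel]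
    ring
  rw [hf2, hf1, hh] at hode
  have hode2 : P ^ s * ((16 * X + 108) * X ^ 2 * (((s + 1 : ℕ) : (ZMod p)[X]) * derivative P *
      (((s + 2 : ℕ) : (ZMod p)[X]) * derivative P * h)) + P * ((16 * X + 108) * X ^ 2 * (((s + 1 : ℕ) : (ZMod p)[X]) * derivative P * derivative h + derivative u) + (32 * X ^ 2 + 108 * X) * u + (3 * X - 3) * P * h)) = 0 := by
    rw [← hode]
    rw [hu]; ring
  have hode3 := (mul_eq_zero.1 hode2).resolve_left (pow_ne_zero _ hPprime.ne_zero)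
  have hdv2 : P ∣ (16 * X + 108) * X ^ 2 * (((s + 1 : ℕ) : (ZMod p)[X]) * derivative P *
      (((s + 2 : ℕ) : (ZMod p)[X]) * derivative P * h)) := by
    refine ⟨-((16 * X + 108) * X ^ 2 * (((s + 1 : ℕ) : (ZMod p)[X]) * derivative P * derivative h + derivative u) + (32 * X ^ 2 + 108 * X) * u + (3 * X - 3) * P * h), ?_⟩
    linear_combination hode3
  simp only [hPprime.dvd_mul] at hdv2
  rcases hdv2 with (h1 | h1) | (h1 | h1) | (h1 | h1) | h1
  · exact hP27 h1
  · exact hPX (hPprime.dvd_of_dvd_pow h1)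
  · exact hnat _ (by omega) (by omega) h1
  · exact hPd h1
  · exact hnat _ (by omega) (by omega) h1
  · exact hPd h1
  · exact hPh h1

theorem hf_simple57 (hpn : p = 2 * n + 1) (h : p = 5 ∨ p = 7) :
    ∃ P : (ZMod p)[X], P.Monic ∧ Irreducible P ∧ P ∣ hf p n ∧ ¬ P ∣ derivative (hf p n) := by
  have hb1 : (hb n 1 : ZMod p) ≠ 0 := hb_ne p n hpn (by omega) (by omega)
  have e : hf p n = C (hb n 1 : ZMod p) * X := by
    ext N
    rw [hf_coeff, coeff_C_mul, coeff_X]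
    split_ifs with h1
    · rw [← h1]; simp
    · have : hb n N = 0 := by
        by_cases h2 : n < 2 * N
        · exact hb_zero_of_lt h2
        · rw [hb, if_neg (by omega)]
      rw [this]; simp
  refine ⟨X, monic_X, irreducible_X, by rw [e]; exact dvd_mul_left _ _, ?_⟩
  rw [e, derivative_mul, derivative_X, derivative_C, zero_mul, zero_add, mul_one, X_dvd_iff]
  simpa using hb1

theorem hf_11 (hpn : p = 2 * n + 1) (h : p = 11) :
    ∃ c : ZMod p, c ≠ 0 ∧ hf p n = C c * X ^ 2 := by
  have hb1 : (hb n 2 : ZMod p) ≠ 0 := hb_ne p n hpn (by omega) (by omega)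
  refine ⟨_, hb1, ?_⟩
  ext N
  rw [hf_coeff, coeff_C_mul, coeff_X_pow]
  split_ifs with h1
  · rw [← h1]; simp
  · have : hb n N = 0 := by
      by_cases h2 : n < 2 * N
      · exact hb_zero_of_lt h2
      · rw [hb, if_neg (by omega)]
    rw [this]; simp

end SimpleRoot2

end PiecePD2

section PiecePB

open Polynomial

section Hasse

theorem coeff_mul_expand {R : Type*} [CommRing R] (p : ℕ) (hp : 1 ≤ p) (u v : R[X]) (M : ℕ)
    (hu : u.natDegree < 2 * p - 1) :
    (u * expand R p v).coeff (p * M + (p - 1)) = u.coeff (p - 1) * v.coeff M := by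
  rw [coeff_mul, Finset.sum_eq_single (p - 1, p * M)]
  · rw [coeff_expand (by omega), if_pos (dvd_mul_right _ _), Nat.mul_div_cancel_left _ (by omega)]
  · rintro ⟨i, j⟩ hij hne
    rw [Finset.HasAntidiagonal.mem_antidiagonal] at hij
    simp only at hij ⊢
    rw [coeff_expand (by omega)]
    split_ifs with hd
    · obtain ⟨l, rfl⟩ := hd
      have hlM : l ≠ M := by
        rintro rfl
        apply hne
        rw [Prod.mk.injEq]; exact ⟨by omega, rfl⟩
      have hl : l < M := by
        by_contra hcon
        have h1 : M + 1 ≤ l := by omega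
        have : p * (M + 1) ≤ p * l := Nat.mul_le_mul_left _ h1
        rw [mul_add] at this
        omega
      have h2 : p * (l + 1) ≤ p * M := Nat.mul_le_mul_left _ hl
      rw [mul_add] at h2
      rw [coeff_eq_zero_of_natDegree_lt (by omega), zero_mul]
    · simp
  · intro h; rw [Finset.HasAntidiagonal.mem_antidiagonal] at h; exact absurd (by simp; omega) h

/-- Hasse invariant -/
noncomputable def hasse {F : Type*} [Field F] (n : ℕ) (A B : F) : F :=
  ((X ^ 3 + C A * X + C B : F[X]) ^ n).coeff (2 * n)

theorem coeff_hasse {F : Type*} [Field F] (p n : ℕ) [hpf : Fact p.Prime] [CharP F p] (hpn : p = 2 * n + 1)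
    (A B : F) (k : ℕ) :
    ((X ^ 3 + C A * X + C B : F[X]) ^ (n * ∑ i ∈ Finset.range k, p ^ i)).coeff (p ^ k - 1) =
      hasse n A B ^ (∑ i ∈ Finset.range k, p ^ i) := by
  have hp1 := hpf.out.one_lt
  induction k with
  | zero => simp
  | succ k ih =>
    set e := ∑ i ∈ Finset.range k, p ^ i with he
    rw [geom_sum_succ, ← he]
    set g := (X ^ 3 + C A * X + C B : F[X]) with hg
    have h1 : g ^ (n * (p * e + 1)) = g ^ n * expand F p (map (frobenius F p) (g ^ (n * e))) := by
      rw [← map_expand, map_frobenius_expand, ← pow_mul, ← pow_add]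
      congr 1; ring
    have hpk : 1 ≤ p ^ k := Nat.one_le_pow _ _ (by omega)
    have h2 : p ^ (k + 1) - 1 = p * (p ^ k - 1) + (p - 1) := by
      rw [Nat.mul_sub, pow_succ, mul_comm (p ^ k) p]
      have : p * 1 ≤ p * p ^ k := Nat.mul_le_mul_left _ hpk
      omega
    rw [h1, h2, coeff_mul_expand p (by omega), coeff_map, ih, frobenius_def]
    · rw [hasse, show p - 1 = 2 * n by omega, ← hg, pow_succ, ← pow_mul, mul_comm, mul_comm e p]
    · refine lt_of_le_of_lt natDegree_pow_le ?_
      have : g.natDegree ≤ 3 := by rw [hg]; compute_degree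
      have : n * g.natDegree ≤ n * 3 := Nat.mul_le_mul_left _ this
      omega

theorem card_points (F : Type) [Field F] [Fintype F] [DecidableEq F] (A B : F) (hΔ : 4 * A ^ 3 + 27 * B ^ 2 ≠ 0)
    (h2 : (2 : F) ≠ 0) :
    curveCard F A B = 1 + ∑ x : F, (Finset.univ.filter fun y : F => y ^ 2 = x ^ 3 + A * x + B).card := by
  set W : WeierstrassCurve.Affine F := WeierstrassCurve.toAffine ⟨0, 0, 0, A, B⟩ with hW
  have heq : ∀ x y, W.Equation x y ↔ y ^ 2 = x ^ 3 + A * x + B := by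
    intro x y
    rw [WeierstrassCurve.Affine.equation_iff]
    simp [hW, WeierstrassCurve.toAffine]
  have hns : ∀ x y, W.Nonsingular x y ↔ y ^ 2 = x ^ 3 + A * x + B := by
    intro x y
    rw [← heq]
    refine ⟨fun h => h.1, fun h => ?_⟩
    rw [WeierstrassCurve.Affine.nonsingular_iff]
    refine ⟨h, ?_⟩
    rw [heq] at h
    simp only [hW, WeierstrassCurve.toAffine]
    by_contra hcon
    push Not at hcon
    obtain ⟨c1, c2⟩ := hcon
    simp only [zero_mul, mul_zero, add_zero, sub_zero] at c1 c2
    have hy : y = 0 := by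
      have : 2 * y = 0 := by linear_combination c2
      exact (mul_eq_zero.1 this).resolve_left h2
    subst hy
    apply hΔ
    have hA : A = -3 * x ^ 2 := by linear_combination -c1
    subst hA
    have hB : B = 2 * x ^ 3 := by linear_combination -h
    rw [hB]; ring
  have e : W.Point ≃ Option {xy : F × F // xy.2 ^ 2 = xy.1 ^ 3 + A * xy.1 + B} :=
    { toFun := fun P => match P with
        | .zero => none
        | .some x y h => some ⟨(x, y), (hns x y).1 h⟩
      invFun := fun o => match o with
        | none => .zero
        | some xy => .some xy.1.1 xy.1.2 ((hns _ _).2 xy.2)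
      left_inv := by rintro (_ | _) <;> rfl
      right_inv := by rintro (_ | _) <;> rfl }
  rw [curveCard, Nat.card_congr e, Nat.card_eq_fintype_card, Fintype.card_option, add_comm]
  congr 1
  rw [Fintype.card_subtype, Finset.card_filter, ← Finset.univ_product_univ, Finset.sum_product]
  refine Finset.sum_congr rfl fun x _ => ?_
  rw [Finset.card_filter]

theorem trace_eq_norm (p n k : ℕ) [hpf : Fact p.Prime] (hp5 : 5 ≤ p) (hpn : p = 2 * n + 1) (hk : 1 ≤ k)
    (F : Type) [Field F] [Fintype F] [Algebra (ZMod p) F] (hF : Fintype.card F = p ^ k) (A B : F)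
    (hΔ : 4 * A ^ 3 + 27 * B ^ 2 ≠ 0) :
    (((p : ℤ) ^ k + 1 - (curveCard F A B : ℤ) : ℤ) : ZMod p) = Algebra.norm (ZMod p) (hasse n A B) := by
  classical
  have : CharP F p := charP_of_injective_algebraMap (algebraMap (ZMod p) F).injective p
  have hchar : ringChar F ≠ 2 := by
    rw [ringChar.eq F p]; omega
  have h2 : (2 : F) ≠ 0 := Ring.two_ne_zero hchar
  have hp1 := hpf.out.one_lt
  apply (algebraMap (ZMod p) F).injective
  set e := ∑ i ∈ Finset.range k, p ^ i with he
  have hge : e * (p - 1) + 1 = p ^ k := by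
    have := Nat.geomSum_eq (m := p) (by omega) k
    rw [← he] at this
    have hd : (p - 1) ∣ p ^ k - 1 := by simpa using Nat.sub_dvd_pow_sub_pow p 1 k
    rw [this, Nat.div_mul_cancel hd]
    have : 1 ≤ p ^ k := Nat.one_le_pow _ _ (by omega)
    omega
  have hge2 : 2 * (n * e) + 1 = p ^ k := by rw [← hge, hpn]; simp; ring
  rw [FiniteField.algebraMap_norm_eq_pow, Nat.card_eq_fintype_card, Nat.card_zmod, hF,
    ← Nat.geomSum_eq (by omega) k, ← coeff_hasse p n hpn A B k, map_intCast, card_points F A B hΔ h2]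
  push_cast
  set g := (X ^ 3 + C A * X + C B : F[X]) with hg
  have hsq : ∀ x : F, ((Finset.univ.filter fun y : F => y ^ 2 = x ^ 3 + A * x + B).card : F) =
      (g ^ (n * e)).eval x + 1 := by
    intro x
    have h := quadraticChar_card_sqrts hchar (x ^ 3 + A * x + B)
    have h' := congrArg (Int.cast : ℤ → F) h
    push_cast at h'
    rw [quadraticChar_eq_pow_of_char_ne_two' hchar, hF] at h'
    rw [eval_pow, hg]
    simp only [eval_add, eval_pow, eval_X, eval_mul, eval_C]
    rw [show p ^ k / 2 = n * e by omega] at h'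
    rw [← h']
    congr 2
    ext y; simp
  rw [Finset.sum_congr rfl fun x _ => hsq x, Finset.sum_add_distrib, sum_eval_eq_neg_coeff, hF]
  · simp [hF, ← he]; ring
  · rw [hF]
    refine lt_of_le_of_lt natDegree_pow_le ?_
    have : g.natDegree ≤ 3 := by rw [hg]; compute_degree
    have : (n * e) * g.natDegree ≤ (n * e) * 3 := Nat.mul_le_mul_left _ this
    have h1k : p ^ 1 ≤ p ^ k := Nat.pow_le_pow_right (by omega) hk
    rw [pow_one] at h1k
    omega

end Hasse
end PiecePB

section PiecePC
open Polynomial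

section Slices

theorem card_singular (F : Type) [Field F] [Fintype F] [DecidableEq F] (h2 : (2 : F) ≠ 0) (h3 : (3 : F) ≠ 0) :
    (Finset.univ.filter fun AB : F × F => 4 * AB.1 ^ 3 + 27 * AB.2 ^ 2 = 0).card = Fintype.card F := by
  rw [← Finset.card_univ]
  symm
  refine Finset.card_bij (fun c _ => (-3 * c ^ 2, 2 * c ^ 3)) ?_ ?_ ?_
  · intro c _
    simp only [Finset.mem_filter, Finset.mem_univ, true_and]
    ring
  · intro c _ d _ h
    simp only [Prod.mk.injEq] at h
    obtain ⟨e1, e2⟩ := h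
    have e1' : c ^ 2 = d ^ 2 := mul_left_cancel₀ (neg_ne_zero.2 h3) e1
    have e2' : c ^ 3 = d ^ 3 := mul_left_cancel₀ h2 e2
    by_cases hd : d = 0
    · subst hd
      simpa using e1'
    · have hd2 : d ^ 2 ≠ 0 := pow_ne_zero _ hd
      apply mul_right_cancel₀ hd2
      linear_combination e2' - c * e1'
  · rintro ⟨A, B⟩ h
    simp only [Finset.mem_filter, Finset.mem_univ, true_and] at h
    have h4 : (4 : F) ≠ 0 := by rw [show (4 : F) = 2 * 2 by norm_num]; exact mul_ne_zero h2 h2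
    have h27 : (27 : F) ≠ 0 := by
      rw [show (27 : F) = 3 ^ 3 by norm_num]; exact pow_ne_zero _ h3
    by_cases hA : A = 0
    · subst hA
      have hB : B = 0 := by
        have : 27 * B ^ 2 = 0 := by linear_combination h
        simpa using (mul_eq_zero.1 this).resolve_left h27
      subst hB
      exact ⟨0, Finset.mem_univ _, by simp⟩
    · refine ⟨-3 * B / (2 * A), Finset.mem_univ _, ?_⟩
      rw [Prod.mk.injEq]
      constructor
      · field_simp
        linear_combination -h
      · field_simp
        linear_combination -B * h

theorem hasse_scale {F : Type*} [Field F] (n : ℕ) (d a : F) (hd : d ≠ 0) :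
    hasse n (d ^ 2 * a) (d ^ 3 * a) = d ^ n * hasse n a a := by
  have h1 : (X ^ 3 + C (d ^ 2 * a) * X + C (d ^ 3 * a) : F[X]).comp (C d * X) =
      C (d ^ 3) * (X ^ 3 + C a * X + C a) := by
    simp only [add_comp, mul_comp, pow_comp, X_comp, C_comp, C_mul, C_pow]
    ring
  have h2 := congrArg (fun g : F[X] => (g ^ n).coeff (2 * n)) h1
  simp only [← pow_comp, comp_C_mul_X_coeff, mul_pow, ← C_pow, coeff_C_mul] at h2
  rw [← hasse, ← hasse] at h2
  have h3 : d ^ (2 * n) ≠ 0 := pow_ne_zero _ hd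
  apply mul_right_cancel₀ h3
  rw [h2]
  ring

variable (p n : ℕ) [hpf : Fact p.Prime]

theorem slice_sum {F : Type} [Field F] [Fintype F] [DecidableEq F] [Algebra (ZMod p) F] (φ : F → ℂ) :
    ∑ AB ∈ (Finset.univ.erase (0 : F)) ×ˢ (Finset.univ.erase (0 : F)), φ (hasse n AB.1 AB.2) =
    ∑ d ∈ Finset.univ.erase (0 : F), ∑ a ∈ Finset.univ.erase (0 : F), φ (d ^ n * aeval a (hf p n)) := by
  rw [← Finset.sum_product']
  symm
  refine Finset.sum_bij' (fun x _ => (x.1 ^ 2 * x.2, x.1 ^ 3 * x.2))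
    (fun y _ => (y.2 / y.1, y.1 ^ 3 / y.2 ^ 2)) ?_ ?_ ?_ ?_ ?_
  · rintro ⟨d, a⟩ h
    simp only [Finset.mem_product, Finset.mem_erase, Finset.mem_univ, and_true] at h ⊢
    exact ⟨mul_ne_zero (pow_ne_zero _ h.1) h.2, mul_ne_zero (pow_ne_zero _ h.1) h.2⟩
  · rintro ⟨A, B⟩ h
    simp only [Finset.mem_product, Finset.mem_erase, Finset.mem_univ, and_true] at h ⊢
    exact ⟨div_ne_zero h.2 h.1, div_ne_zero (pow_ne_zero _ h.1) (pow_ne_zero _ h.2)⟩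
  · rintro ⟨d, a⟩ h
    simp only [Finset.mem_product, Finset.mem_erase, Finset.mem_univ, and_true] at h ⊢
    obtain ⟨h1, h2⟩ := h
    rw [Prod.mk.injEq]
    constructor <;> field_simp
  · rintro ⟨A, B⟩ h
    simp only [Finset.mem_product, Finset.mem_erase, Finset.mem_univ, and_true] at h ⊢
    obtain ⟨h1, h2⟩ := h
    rw [Prod.mk.injEq]
    constructor <;> field_simp
  · rintro ⟨d, a⟩ h
    simp only [Finset.mem_product, Finset.mem_erase, Finset.mem_univ, and_true] at h ⊢
    rw [hasse_scale n d a h.1, hf_aeval, hasse]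

theorem sum_norm_zero {F : Type} [Field F] [Fintype F] [Algebra (ZMod p) F] (χ : MulChar (ZMod p) ℂ)
    (hχ : χ ≠ 1) : ∑ d : F, χ (Algebra.norm (ZMod p) d) = 0 := by
  obtain ⟨u, hu⟩ := MulChar.ne_one_iff.1 hχ
  obtain ⟨c, hc⟩ := FiniteField.norm_surjective (ZMod p) F (u : ZMod p)
  have hc0 : c ≠ 0 := by
    rintro rfl
    rw [Algebra.norm_zero] at hc
    exact u.ne_zero hc.symm
  have h1 : ∑ d : F, χ (Algebra.norm (ZMod p) (c * d)) = ∑ d : F, χ (Algebra.norm (ZMod p) d) :=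
    Fintype.sum_equiv (Equiv.mulLeft₀ c hc0) _ _ (fun _ => rfl)
  simp only [map_mul, hc, ← Finset.mul_sum] at h1
  by_contra h0
  exact hu (mul_right_cancel₀ h0 (by rw [h1, one_mul]))

theorem hf_aeval_zero (hn : 1 ≤ n) {F : Type} [Field F] [Algebra (ZMod p) F] : aeval (0 : F) (hf p n) = 0 := by
  rw [← coeff_zero_eq_aeval_zero', hf_coeff, hb, if_neg (by omega)]; simp

theorem char_sum_main (hp5 : 5 ≤ p) (hpn : p = 2 * n + 1) {F : Type} [Field F] [Fintype F] [DecidableEq F]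
    [Algebra (ZMod p) F] (χ : MulChar (ZMod p) ℂ) (hχ : χ ≠ 1) :
    ‖∑ AB ∈ (Finset.univ.erase (0 : F)) ×ˢ (Finset.univ.erase (0 : F)),
      χ (Algebra.norm (ZMod p) (hasse n AB.1 AB.2))‖ ≤
      (Fintype.card F : ℝ) * ((hf p n).natDegree * Real.sqrt (Fintype.card F)) := by
  rw [slice_sum p n (fun y => χ (Algebra.norm (ZMod p) y))]
  simp only [map_mul, map_pow, ← Finset.mul_sum, ← Finset.sum_mul]
  have hz : ∑ a ∈ Finset.univ.erase (0 : F), χ (Algebra.norm (ZMod p) (aeval a (hf p n))) =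
      ∑ a : F, χ (Algebra.norm (ZMod p) (aeval a (hf p n))) := by
    rw [Finset.sum_erase]
    rw [hf_aeval_zero p n (by omega), Algebra.norm_zero, MulChar.map_zero]
  have hz2 : ∑ d ∈ Finset.univ.erase (0 : F), χ (Algebra.norm (ZMod p) d) ^ n =
      ∑ d : F, (χ ^ n) (Algebra.norm (ZMod p) d) := by
    rw [← Finset.sum_erase Finset.univ (a := (0 : F)) (f := fun d => (χ ^ n) (Algebra.norm (ZMod p) d))
      (by simp [Algebra.norm_zero, MulChar.map_zero])]
    refine Finset.sum_congr rfl fun d _ => ?_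
    rw [MulChar.pow_apply' _ (by omega)]
  rw [hz]
  by_cases h11 : p = 11
  · obtain ⟨c, hc, hfe⟩ := hf_11 p n hpn h11
    have hn5 : n = 5 := by omega
    have : (∑ d ∈ Finset.univ.erase (0 : F), χ (Algebra.norm (ZMod p) d) ^ n) *
        ∑ a : F, χ (Algebra.norm (ZMod p) (aeval a (hf p n))) = 0 := by
      rw [mul_eq_zero]
      by_cases h5 : χ ^ n = 1
      · right
        have h22 : χ ^ 2 ≠ 1 := by
          intro h
          apply hχ
          rw [hn5] at h5
          calc χ = χ ^ 5 * ((χ ^ 2) ^ 2)⁻¹ := by group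
            _ = 1 := by rw [h5, h]; simp
        simp only [hfe, map_mul, map_pow, aeval_C, aeval_X, ← Finset.mul_sum]
        have := sum_norm_zero p (F := F) (χ ^ 2) h22
        simp only [MulChar.pow_apply' _ (two_ne_zero)] at this
        rw [this, mul_zero]
      · left
        rw [hz2]
        exact sum_norm_zero p (χ ^ n) h5
    rw [this, norm_zero]; positivity
  · obtain ⟨P, hPm, hPi, hPf, hPd⟩ : ∃ P : (ZMod p)[X], P.Monic ∧ Irreducible P ∧ P ∣ hf p n ∧
        ¬ P ∣ derivative (hf p n) := by
      by_cases h13 : 13 ≤ p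
      · exact hf_simple p n h13 hpn
      · apply hf_simple57 p n hpn
        have := hpf.out
        have h9 : p ≠ 9 := by rintro rfl; norm_num at this
        omega
    have hw := weil_bound p hp5 (hf p n) P hPm hPi hPf hPd χ hχ F
    rw [norm_mul]
    refine mul_le_mul ?_ hw (norm_nonneg _) (by positivity)
    refine (norm_sum_le _ _).trans ?_
    calc ∑ d ∈ Finset.univ.erase (0 : F), ‖χ (Algebra.norm (ZMod p) d) ^ n‖
        ≤ ∑ d ∈ Finset.univ.erase (0 : F), (1 : ℝ) := by
          refine Finset.sum_le_sum fun d _ => ?_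
          rw [norm_pow]
          exact pow_le_one₀ (norm_nonneg _) (DirichletCharacter.norm_le_one χ _)
      _ ≤ Fintype.card F := by
          rw [Finset.sum_const, nsmul_eq_mul, mul_one]
          exact_mod_cast Finset.card_le_univ _

theorem zero_count_main (hp5 : 5 ≤ p) (hpn : p = 2 * n + 1) {F : Type} [Field F] [Fintype F] [DecidableEq F]
    [Algebra (ZMod p) F] :
    (((Finset.univ.erase (0 : F)) ×ˢ (Finset.univ.erase (0 : F))).filter
      fun AB => hasse n AB.1 AB.2 = 0).card ≤ Fintype.card F * (hf p n).natDegree := by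
  have h1 := slice_sum p n (fun y : F => if y = 0 then (1 : ℂ) else 0)
  have hf0 : hf p n ≠ 0 := by
    intro h
    have : (hf p n).coeff ((n + 2) / 3) ≠ 0 := by
      rw [hf_coeff]; exact hb_ne p n hpn (by omega) (by omega)
    rw [h] at this; simp at this
  have hroots : ((Finset.univ.erase (0 : F)).filter fun a => aeval a (hf p n) = 0).card ≤ (hf p n).natDegree := by
    have : (Finset.univ.erase (0 : F)).filter (fun a => aeval a (hf p n) = 0) ⊆
        ((hf p n).map (algebraMap (ZMod p) F)).roots.toFinset := by
      intro α hα
      have hα := (Finset.mem_filter.1 hα).2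
      rw [Multiset.mem_toFinset, mem_roots, IsRoot, eval_map_algebraMap, hα]
      rw [Polynomial.map_ne_zero_iff (algebraMap (ZMod p) _).injective]; exact hf0
    refine (Finset.card_le_card this).trans ((Multiset.toFinset_card_le _).trans ((card_roots' _).trans ?_))
    exact natDegree_map_le
  have h2 : ∀ d ∈ Finset.univ.erase (0 : F), ∑ a ∈ Finset.univ.erase (0 : F),
      (if d ^ n * aeval a (hf p n) = 0 then (1 : ℂ) else 0) =
      (((Finset.univ.erase (0 : F)).filter fun a => aeval a (hf p n) = 0).card : ℂ) := by
    intro d hd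
    have hd0 : d ^ n ≠ 0 := pow_ne_zero _ (Finset.ne_of_mem_erase hd)
    simp [hd0]
  rw [Finset.sum_congr rfl h2, Finset.sum_const, ← Finset.sum_filter, Finset.sum_const] at h1
  simp only [nsmul_eq_mul, mul_one] at h1
  have h3 : (((Finset.univ.erase (0 : F)) ×ˢ (Finset.univ.erase (0 : F))).filter
      fun AB => hasse n AB.1 AB.2 = 0).card = (Finset.univ.erase (0 : F)).card *
        ((Finset.univ.erase (0 : F)).filter fun a => aeval a (hf p n) = 0).card := by exact_mod_cast h1
  rw [h3]
  exact Nat.mul_le_mul (Finset.card_le_univ _) hroots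

end Slices
end PiecePC


section Final

theorem orth_bound (p : ℕ) [Fact p.Prime] {ι : Type*} (S : Finset ι) (h : ι → ZMod p)
    (t : ZMod p) (ht : t ≠ 0) (E : ℝ)
    (hE : ∀ χ : MulChar (ZMod p) ℂ, χ ≠ 1 → ‖∑ i ∈ S, χ (h i)‖ ≤ E)
    (h0 : ((S.filter fun i => h i = 0).card : ℝ) ≤ E) :
    |((S.filter fun i => h i = t).card : ℝ) - (S.card : ℝ) / ((p : ℝ) - 1)| ≤ E := by
  classical
  have hp : p.Prime := Fact.out
  have hp1 : (0 : ℝ) < (p : ℝ) - 1 := by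
    have : (1 : ℝ) < p := by exact_mod_cast hp.one_lt
    linarith
  have htot : ((p.totient : ℕ) : ℝ) = (p : ℝ) - 1 := by
    rw [Nat.totient_prime hp, Nat.cast_sub hp.one_le]; simp
  have htotC : ((p.totient : ℕ) : ℂ) = (((p : ℝ) - 1 : ℝ) : ℂ) := by
    rw [← htot]; simp
  have key : (((p : ℝ) - 1 : ℝ) : ℂ) * ((S.filter fun i => h i = t).card : ℂ) =
      ∑ χ : DirichletCharacter ℂ p, χ t⁻¹ * ∑ i ∈ S, χ (h i) := by
    have h1 : ∑ χ : DirichletCharacter ℂ p, χ t⁻¹ * ∑ i ∈ S, χ (h i) =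
        ∑ i ∈ S, ∑ χ : DirichletCharacter ℂ p, χ t⁻¹ * χ (h i) := by
      rw [Finset.sum_comm]
      exact Finset.sum_congr rfl fun χ _ => Finset.mul_sum _ _ _
    rw [h1, Finset.sum_congr rfl fun i _ =>
      DirichletCharacter.sum_char_inv_mul_char_eq ℂ (isUnit_iff_ne_zero.mpr ht) (h i)]
    rw [← Finset.sum_filter, Finset.sum_const, htotC, nsmul_eq_mul, mul_comm]
    simp only [eq_comm]
  have hdev : ∀ χ : DirichletCharacter ℂ p,
      ‖χ t⁻¹ * (∑ i ∈ S, χ (h i)) - (if χ = 1 then (S.card : ℂ) else 0)‖ ≤ E := by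
    intro χ
    by_cases hχ : χ = 1
    · subst hχ
      rw [if_pos rfl, MulChar.one_apply (isUnit_iff_ne_zero.mpr (inv_ne_zero ht)), one_mul]
      have h2 : ∑ i ∈ S, (1 : DirichletCharacter ℂ p) (h i) =
          ((S.filter fun i => ¬ h i = 0).card : ℂ) := by
        rw [Finset.card_filter, Nat.cast_sum]
        refine Finset.sum_congr rfl fun i _ => ?_
        by_cases hi : h i = 0
        · simp [hi, MulChar.map_zero]
        · simp [hi, MulChar.one_apply (isUnit_iff_ne_zero.mpr hi)]
      have h3 := Finset.card_filter_add_card_filter_not (s := S) (fun i => h i = 0)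
      rw [h2, ← h3]
      push_cast
      rw [sub_add_cancel_right, norm_neg]
      simpa using h0
    · rw [if_neg hχ, sub_zero, norm_mul]
      calc _ ≤ 1 * ‖∑ i ∈ S, χ (h i)‖ :=
            mul_le_mul_of_nonneg_right (DirichletCharacter.norm_le_one χ _) (norm_nonneg _)
        _ ≤ E := by rw [one_mul]; exact hE χ hχ
  have hsum : ∑ χ : DirichletCharacter ℂ p,
      (χ t⁻¹ * (∑ i ∈ S, χ (h i)) - (if χ = 1 then (S.card : ℂ) else 0)) =
      (((p : ℝ) - 1 : ℝ) : ℂ) * ((S.filter fun i => h i = t).card : ℂ) - S.card := by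
    rw [Finset.sum_sub_distrib, ← key]
    simp
  have hb : ‖(((p : ℝ) - 1 : ℝ) : ℂ) * ((S.filter fun i => h i = t).card : ℂ) - S.card‖ ≤
      ((p : ℝ) - 1) * E := by
    rw [← hsum]
    refine (norm_sum_le_of_le _ fun χ _ => hdev χ).trans ?_
    rw [Finset.sum_const, nsmul_eq_mul, Finset.card_univ, ← Nat.card_eq_fintype_card,
      DirichletCharacter.card_eq_totient_of_hasEnoughRootsOfUnity ℂ p, htot]
  have hb2 : |((p : ℝ) - 1) * ((S.filter fun i => h i = t).card : ℝ) - S.card| ≤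
      ((p : ℝ) - 1) * E := by
    rw [← Real.norm_eq_abs, ← Complex.norm_real]
    push_cast at hb ⊢
    exact hb
  have h4 : ((S.filter fun i => h i = t).card : ℝ) - (S.card : ℝ) / ((p : ℝ) - 1) =
      (((p : ℝ) - 1) * ((S.filter fun i => h i = t).card : ℝ) - S.card) / ((p : ℝ) - 1) := by
    field_simp
  rw [h4, abs_div, abs_of_pos hp1, div_le_iff₀ hp1]
  linarith

/-- A sum of terms of norm at most one over a set changes by at most the size of the symmetric
difference. -/
theorem norm_sum_change {ι : Type*} [Fintype ι] [DecidableEq ι] (S M : Finset ι) (f : ι → ℂ)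
    (hf : ∀ i, ‖f i‖ ≤ 1) :
    ‖∑ i ∈ S, f i‖ ≤ ‖∑ i ∈ M, f i‖ + Sᶜ.card + Mᶜ.card := by
  have h1 := Finset.sum_add_sum_compl S f
  have h2 := Finset.sum_add_sum_compl M f
  have h3 : ∑ i ∈ S, f i = ∑ i ∈ M, f i + ∑ i ∈ Mᶜ, f i - ∑ i ∈ Sᶜ, f i := by
    rw [h2, ← h1]; ring
  have hc : ∀ T : Finset ι, ‖∑ i ∈ T, f i‖ ≤ T.card := by
    intro T
    refine (norm_sum_le_of_le T fun i _ => hf i).trans ?_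
    simp
  rw [h3]
  refine (norm_sub_le _ _).trans ?_
  have := norm_add_le (∑ i ∈ M, f i) (∑ i ∈ Mᶜ, f i)
  linarith [hc Mᶜ, hc Sᶜ]

end Final

theorem stmt15 (p k : ℕ) (hp : p.Prime) (hp5 : 5 ≤ p) (hk : 1 ≤ k)
    (F : Type) [Field F] [Fintype F] (hF : Fintype.card F = p ^ k)
    (t : ℕ) (ht1 : 1 ≤ t) (ht2 : t ≤ p - 1) :
    Nat.card {AB : F × F // 4 * AB.1 ^ 3 + 27 * AB.2 ^ 2 ≠ 0} = p ^ (2 * k) - p ^ k ∧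
    |(Nat.card {AB : F × F // 4 * AB.1 ^ 3 + 27 * AB.2 ^ 2 ≠ 0 ∧
          ((p : ℤ) ^ k + 1 - (curveCard F AB.1 AB.2 : ℤ)) ≡ (t : ℤ) [ZMOD (p : ℤ)]} : ℝ) -
        (Nat.card {AB : F × F // 4 * AB.1 ^ 3 + 27 * AB.2 ^ 2 ≠ 0} : ℝ) / ((p : ℝ) - 1)| ≤
      3 * (p : ℝ) * (p : ℝ) ^ k * Real.sqrt ((p : ℝ) ^ k) := by
  classical
  haveI : Fact p.Prime := ⟨hp⟩
  haveI : CharP F p := charP_of_card_eq_prime_pow hF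
  letI : Algebra (ZMod p) F := ZMod.algebra F p
  obtain ⟨n, hpn⟩ : ∃ n, p = 2 * n + 1 := hp.odd_of_ne_two (by omega)
  have hsmall : ∀ a : ℕ, 0 < a → a < p → (a : F) ≠ 0 := by
    intro a ha hap h
    rw [CharP.cast_eq_zero_iff F p] at h
    exact absurd (Nat.le_of_dvd ha h) (by omega)
  have h2 : (2 : F) ≠ 0 := by exact_mod_cast hsmall 2 (by norm_num) (by omega)
  have h3 : (3 : F) ≠ 0 := by exact_mod_cast hsmall 3 (by norm_num) (by omega)
  set S : Finset (F × F) := Finset.univ.filter fun AB => 4 * AB.1 ^ 3 + 27 * AB.2 ^ 2 ≠ 0 with hS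
  have hSc : Sᶜ.card = p ^ k := by
    rw [← hF, ← card_singular F h2 h3]
    congr 1
    ext AB
    simp [hS]
  have hall : Fintype.card (F × F) = p ^ (2 * k) := by
    rw [Fintype.card_prod, hF]; ring
  have hScard : Nat.card {AB : F × F // 4 * AB.1 ^ 3 + 27 * AB.2 ^ 2 ≠ 0} = S.card := by
    rw [Nat.card_eq_fintype_card, Fintype.card_subtype]
  have hadd := Finset.card_add_card_compl S
  refine ⟨by rw [hScard]; omega, ?_⟩
  have hT : Nat.card {AB : F × F // 4 * AB.1 ^ 3 + 27 * AB.2 ^ 2 ≠ 0 ∧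
          ((p : ℤ) ^ k + 1 - (curveCard F AB.1 AB.2 : ℤ)) ≡ (t : ℤ) [ZMOD (p : ℤ)]} =
      (S.filter fun AB => Algebra.norm (ZMod p) (hasse n AB.1 AB.2) = (t : ZMod p)).card := by
    rw [Nat.card_eq_fintype_card, Fintype.card_subtype, hS, Finset.filter_filter]
    congr 1
    refine Finset.filter_congr fun AB _ => and_congr_right fun hΔ => ?_
    rw [← ZMod.intCast_eq_intCast_iff, trace_eq_norm p n k hp5 hpn hk F hF AB.1 AB.2 hΔ]
    simp
  have ht0 : (t : ZMod p) ≠ 0 := by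
    intro h
    rw [ZMod.natCast_eq_zero_iff] at h
    exact absurd (Nat.le_of_dvd ht1 h) (by omega)
  set M : Finset (F × F) := (Finset.univ.erase (0 : F)) ×ˢ (Finset.univ.erase (0 : F)) with hM
  have hMc : Mᶜ.card ≤ 2 * p ^ k := by
    have h5 := Finset.card_add_card_compl M
    have h6 : M.card = (p ^ k - 1) * (p ^ k - 1) := by
      rw [hM, Finset.card_product, Finset.card_erase_of_mem (Finset.mem_univ _),
        Finset.card_univ, hF]
    have h7 : Fintype.card (F × F) = p ^ k * p ^ k := by rw [Fintype.card_prod, hF]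
    have h8 : 1 ≤ p ^ k := Nat.one_le_pow _ _ hp.pos
    obtain ⟨q, hq⟩ : ∃ q, p ^ k = q + 1 := ⟨p ^ k - 1, by omega⟩
    rw [h6, h7, hq, Nat.add_sub_cancel] at h5
    rw [hq]
    nlinarith
  set m := (hf p n).natDegree with hm
  have hmn : 2 * m ≤ n := hf_natDegree p n
  set q : ℝ := (p : ℝ) ^ k with hq
  have hcardq : (Fintype.card F : ℝ) = q := by rw [hF, hq]; push_cast; rfl
  have hq1 : 1 ≤ q := one_le_pow₀ (by exact_mod_cast hp.one_le)
  have hs1 : 1 ≤ Real.sqrt q := Real.one_le_sqrt.mpr hq1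
  have hScR : (Sᶜ.card : ℝ) = q := by rw [hSc, hq]; push_cast; rfl
  have hMcR : (Mᶜ.card : ℝ) ≤ 2 * q := by rw [hq]; exact_mod_cast hMc
  have main := orth_bound p S (fun AB => Algebra.norm (ZMod p) (hasse n AB.1 AB.2)) t ht0
    (q * (m * Real.sqrt q) + 3 * q) ?_ ?_
  · rw [hT, hScard]
    refine main.trans ?_
    have hmp : (m : ℝ) + 3 ≤ 3 * p := by
      have : m + 3 ≤ 3 * p := by omega
      exact_mod_cast this
    have hqs : q ≤ q * Real.sqrt q := le_mul_of_one_le_right (by linarith) hs1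
    have : 0 ≤ q * Real.sqrt q := by positivity
    nlinarith
  · intro χ hχ
    have hc := char_sum_main p n hp5 hpn (F := F) χ hχ
    rw [hcardq] at hc
    have := norm_sum_change S M (fun AB => χ (Algebra.norm (ZMod p) (hasse n AB.1 AB.2)))
      fun AB => DirichletCharacter.norm_le_one χ _
    linarith
  · have hz := zero_count_main p n hp5 hpn (F := F)
    have hsub : (S.filter fun AB => Algebra.norm (ZMod p) (hasse n AB.1 AB.2) = 0) ⊆
        (M.filter fun AB => hasse n AB.1 AB.2 = 0) ∪ Mᶜ := by
      intro AB hAB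
      rw [Finset.mem_filter, Algebra.norm_eq_zero_iff] at hAB
      by_cases hin : AB ∈ M
      · exact Finset.mem_union_left _ (Finset.mem_filter.mpr ⟨hin, hAB.2⟩)
      · exact Finset.mem_union_right _ (Finset.mem_compl.mpr hin)
    have hle := (Finset.card_le_card hsub).trans (Finset.card_union_le _ _)
    have hleR : ((S.filter fun AB => Algebra.norm (ZMod p) (hasse n AB.1 AB.2) = 0).card : ℝ) ≤
        q * m + 2 * q := by
      have hzR : ((M.filter fun AB => hasse n AB.1 AB.2 = 0).card : ℝ) ≤ q * m := by
        rw [← hcardq]; exact_mod_cast hz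
      have : ((S.filter fun AB => Algebra.norm (ZMod p) (hasse n AB.1 AB.2) = 0).card : ℝ) ≤
          ((M.filter fun AB => hasse n AB.1 AB.2 = 0).card : ℝ) + (Mᶜ.card : ℝ) := by
        exact_mod_cast hle
      linarith
    refine hleR.trans ?_
    have : q * (m : ℝ) ≤ q * (m * Real.sqrt q) := by
      refine mul_le_mul_of_nonneg_left ?_ (by linarith)
      exact le_mul_of_one_le_right (by positivity) hs1
    linarith
end

section
/- Let $p \ge 5$ be a prime and let $c_{A,B} \in \mathbb{F}_p[A,B]$ be the coefficient of $x^{p-1}$ in $(x^3 + Ax + B)^{(p-1)/2} \in \mathbb{F}_p[A,B][x]$. Then $c_{A,B}$ is nonzero, is weighted homogeneous of degree $(p-1)/2$ when $A$ is given weight $2$ and $B$ weight $3$, and is squarefree as an element of $\overline{\mathbb{F}}_p[A,B]$. -/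
/-- `c_{A,B} ∈ F_p[A,B]`: the coefficient of `x^(p-1)` in `(x³ + Ax + B)^((p-1)/2)`,
where `A` and `B` are the variables `X 0` and `X 1` of `MvPolynomial (Fin 2) (ZMod p)`. -/
noncomputable def cAB (p : ℕ) : MvPolynomial (Fin 2) (ZMod p) :=
  Polynomial.coeff
    ((Polynomial.X ^ 3 + Polynomial.C (MvPolynomial.X 0) * Polynomial.X +
        Polynomial.C (MvPolynomial.X 1)) ^ ((p - 1) / 2))
    (p - 1)

open Polynomial

theorem aux_dvd {K : Type*} [Field K] (p m : ℕ) [CharP K p] (hm : m < p)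
    (f W : K[X]) (hf : IsCoprime f (derivative f)) (hf0 : f ≠ 0)
    (h : f * derivative W = C (m:K) * derivative f * W) (k : ℕ) (hk : k ≤ m) : f ^ k ∣ W := by
  induction k with
  | zero => simp
  | succ k ih =>
    obtain ⟨R, rfl⟩ := ih (by omega)
    have h2 : f ^ k * (f * derivative R) = f ^ k * (C ((m:K) - k) * derivative f * R) := by
      rw [derivative_mul, derivative_pow] at h
      rcases k with _ | k
      · simpa using h
      · simp only [Nat.add_sub_cancel] at h
        rw [C_sub]
        linear_combination h
    have h3 := mul_left_cancel₀ (pow_ne_zero k hf0) h2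
    have h4 : ((m:K) - k) ≠ 0 := by
      rw [← Nat.cast_sub (by omega), Ne, CharP.cast_eq_zero_iff K p]
      intro hd
      have := Nat.le_of_dvd (by omega) hd
      omega
    have h5 : f ∣ derivative f * (C ((m:K) - k) * R) :=
      ⟨derivative R, by linear_combination -h3⟩
    have h6 := hf.dvd_of_dvd_mul_left h5
    have h7 : f ∣ R := by
      obtain ⟨S, hS⟩ := h6
      refine ⟨C ((m:K)-k)⁻¹ * S, ?_⟩
      have : C ((m:K)-k)⁻¹ * C ((m:K)-k) = 1 := by rw [← C_mul, inv_mul_cancel₀ h4, C_1]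
      linear_combination C ((m:K)-k)⁻¹ * hS - R * this
    rw [pow_succ]
    exact mul_dvd_mul_left _ h7

theorem aux_zero {K : Type*} [Field K] (p m : ℕ) [CharP K p] (hm : m < p)
    (f W : K[X]) (hf : IsCoprime f (derivative f)) (hf0 : f ≠ 0)
    (h : f * derivative W = C (m:K) * derivative f * W) (hd : W.natDegree < m * f.natDegree) :
    W = 0 := by
  by_contra hW
  have h1 := aux_dvd p m hm f W hf hf0 h m le_rfl
  have := natDegree_le_of_dvd h1 hW
  rw [natDegree_pow] at this
  omega

noncomputable def ff {R : Type*} [CommRing R] (a b : R) : R[X] := X ^ 3 + C a * X + C b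

theorem ff_natDegree {R : Type*} [CommRing R] [Nontrivial R] (a b : R) : (ff a b).natDegree = 3 := by
  unfold ff; compute_degree!

theorem ff_ne {R : Type*} [CommRing R] [Nontrivial R] (a b : R) : ff a b ≠ 0 := by
  intro h; have := ff_natDegree a b; rw [h] at this; simp at this

theorem ff_deriv {R : Type*} [CommRing R] (a b : R) : derivative (ff a b) = 3 * X ^ 2 + C a := by
  have h3 : (C (3 : R) : R[X]) = 3 := rfl
  simp only [ff, derivative_add, derivative_X_pow, derivative_mul, derivative_C, derivative_X]
  push_cast
  rw [h3]; ring

theorem ff_coprime {K : Type*} [Field K] (a b : K) (h : 4 * a ^ 3 + 27 * b ^ 2 ≠ 0) :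
    IsCoprime (ff a b) (derivative (ff a b)) := by
  rw [ff_deriv, ff]
  have hC : C (4 * a ^ 3 + 27 * b ^ 2)⁻¹ * (4 * C a ^ 3 + 27 * C b ^ 2) = 1 := by
    have : (4 * C a ^ 3 + 27 * C b ^ 2 : K[X]) = C (4 * a ^ 3 + 27 * b ^ 2) := by
      have h4 : (C (4 : K) : K[X]) = 4 := rfl
      have h27 : (C (27 : K) : K[X]) = 27 := rfl
      simp [h4, h27]
    rw [this, ← C_mul, inv_mul_cancel₀ h, C_1]
  -- (27 b - 18 a x) f + (6 a x^2 - 9 b x + 4 a^2) f' = 4 a^3 + 27 b^2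
  refine ⟨C (4 * a ^ 3 + 27 * b ^ 2)⁻¹ * (27 * C b - 18 * C a * X),
    C (4 * a ^ 3 + 27 * b ^ 2)⁻¹ * (6 * C a * X ^ 2 - 9 * C b * X + 4 * C a ^ 2), ?_⟩
  linear_combination hC

theorem smooth_case {K : Type*} [Field K] (p m : ℕ) [Fact p.Prime] [CharP K p] (hpm : p = 2 * m + 5)
    (a b : K) (h : 4 * a ^ 3 + 27 * b ^ 2 ≠ 0)
    (h1 : ((ff a b) ^ (m + 1)).coeff (p - 1) = 0) (h2 : ((ff a b) ^ (m + 1)).coeff (p - 2) = 0) :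
    False := by
  set f := ff a b with hf
  have hcop := ff_coprime a b h
  rw [← hf] at hcop
  have hp : p.Prime := Fact.out
  have hpK : (p : K) = 0 := CharP.cast_eq_zero K p
  set y := f ^ (m + 1) with hy
  have hode : f * derivative y = C ((m + 1 : ℕ) : K) * derivative f * y := by
    rw [hy, derivative_pow, Nat.add_sub_cancel]; ring
  have hrec : ∀ n : ℕ, ((n : K) - 3 * (m + 1)) * y.coeff n + a * (n + 2 - (m + 1)) * y.coeff (n + 2)
      + b * (n + 3) * y.coeff (n + 3) = 0 := by
    intro n
    have h0 : X ^ 3 * derivative y + C a * (X * derivative y) + C b * derivative y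
        - C ((m + 1 : ℕ) : K) * (3 * (X ^ 2 * y) + C a * y) = 0 := by
      rw [hf, ff_deriv, ff] at hode
      linear_combination hode
    have h3 := congrArg (fun q => coeff q (n + 2)) h0
    have e1 : (X ^ 3 * derivative y).coeff (n + 2) = n * y.coeff n := by
      rcases n with _ | n
      · simp [coeff_X_pow_mul']
      · rw [coeff_X_pow_mul', if_pos (by omega), coeff_derivative]
        simp [mul_comm]
    have e2 : (X * derivative y).coeff (n + 2) = (n + 2) * y.coeff (n + 2) := by
      rw [coeff_X_mul, coeff_derivative]; push_cast; ring
    have e3 : (X ^ 2 * y).coeff (n + 2) = y.coeff n := by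
      rw [coeff_X_pow_mul]
    have e4 : (3 * (X ^ 2 * y)).coeff (n + 2) = 3 * y.coeff n := by
      rw [← e3, ← coeff_C_mul]; rfl
    simp only [coeff_sub, coeff_add, coeff_C_mul, e1, e2, e4, coeff_derivative, coeff_zero] at h3
    push_cast at h3
    linear_combination h3
  have hz : ∀ d n, d + n + 1 = p → m < n + 2 → y.coeff n = 0 := by
    intro d
    induction d using Nat.strong_induction_on with
    | _ d ih =>
      intro n hn hmn
      match d, ih with
      | 0, _ => rw [← h1]; congr 1; omega
      | 1, _ => rw [← h2]; congr 1; omega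
      | 2, ih =>
        have := hrec n
        rw [ih 0 (by omega) (n + 2) (by omega) (by omega)] at this
        have h3 : (n : K) + 3 = 0 := by rw [← hpK, ← hn]; push_cast; ring
        rw [h3] at this
        have h4 : ((n : K) - 3 * (m + 1)) = ((n + 2 - m : ℕ) : K) := by
          rw [Nat.cast_sub (by omega)]
          rw [hpm] at hpK; push_cast at hpK ⊢
          linear_combination -hpK
        have h5 : ((n + 2 - m : ℕ) : K) ≠ 0 := by
          rw [Ne, CharP.cast_eq_zero_iff K p]
          intro hd
          have := Nat.le_of_dvd (by omega) hd
          omega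
        rw [h4] at this
        simpa [h5] using this
      | d + 3, ih =>
        have := hrec n
        rw [ih (d + 1) (by omega) (n + 2) (by omega) (by omega),
          ih d (by omega) (n + 3) (by omega) (by omega)] at this
        have h4 : ((n : K) - 3 * (m + 1)) = ((n + 2 - m : ℕ) : K) := by
          rw [Nat.cast_sub (by omega)]
          rw [hpm] at hpK; push_cast at hpK ⊢
          linear_combination -hpK
        have h5 : ((n + 2 - m : ℕ) : K) ≠ 0 := by
          rw [Ne, CharP.cast_eq_zero_iff K p]
          intro hd
          have := Nat.le_of_dvd (by omega) hd
          omega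
        rw [h4] at this
        simpa [h5] using this
  have hmon : (X ^ p : K[X]).Monic := monic_X_pow p
  set P := y %ₘ X ^ p with hP
  set Q := y /ₘ X ^ p with hQ
  have hPQ : P + X ^ p * Q = y := modByMonic_add_div _ _
  have hfd : f.natDegree = 3 := ff_natDegree a b
  have hPlt : ∀ n, m < n + 2 → P.coeff n = 0 := by
    intro n hn
    by_cases hnp : n < p
    · have := hz (p - 1 - n) n (by omega) hn
      rw [← hPQ, coeff_add, coeff_X_pow_mul', if_neg (by omega), add_zero] at this
      exact this
    · apply coeff_eq_zero_of_degree_lt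
      refine lt_of_lt_of_le (degree_modByMonic_lt y hmon) ?_
      rw [degree_X_pow]; exact_mod_cast (by omega : p ≤ n)
  have hPd : P.natDegree ≤ m := by
    rw [natDegree_le_iff_coeff_eq_zero]
    intro n hn; exact hPlt n (by omega)
  have hderiv : derivative y = derivative P + X ^ p * derivative Q := by
    rw [← hPQ, derivative_add, derivative_mul, derivative_X_pow, hpK]; simp
  set U := f * derivative P - C ((m + 1 : ℕ) : K) * derivative f * P with hU
  set V := f * derivative Q - C ((m + 1 : ℕ) : K) * derivative f * Q with hV
  have hUV : U + X ^ p * V = 0 := by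
    rw [hderiv] at hode
    rw [← hPQ] at hode
    rw [hU, hV]; linear_combination hode
  have hUd : U.natDegree < p := by
    have e1 : (f * derivative P).natDegree ≤ 3 + m := by
      refine natDegree_mul_le.trans ?_
      have := natDegree_derivative_le P
      omega
    have e2 : (C ((m + 1 : ℕ) : K) * derivative f * P).natDegree ≤ 3 + m := by
      refine natDegree_mul_le.trans ?_
      have := natDegree_C_mul_le ((m + 1 : ℕ) : K) (derivative f)
      have := natDegree_derivative_le f
      omega
    have := natDegree_sub_le_of_le e1 e2
    rw [max_self, ← hU] at this
    omega
  have hU0 : U = 0 := by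
    by_contra hne
    have : (X ^ p : K[X]) ∣ U := ⟨-V, by linear_combination hUV⟩
    have := natDegree_le_of_dvd this hne
    rw [natDegree_X_pow] at this; omega
  have hV0 : V = 0 := by
    rw [hU0, zero_add] at hUV
    exact (mul_eq_zero.mp hUV).resolve_left hmon.ne_zero
  have hP0 : P = 0 := aux_zero p (m + 1) (by omega) f P hcop (ff_ne a b)
    (sub_eq_zero.mp hU0) (by rw [hfd]; omega)
  have hQ0 : Q = 0 := aux_zero p (m + 1) (by omega) f Q hcop (ff_ne a b)
    (sub_eq_zero.mp hV0) (by
      rw [hfd, hQ, natDegree_divByMonic _ hmon, natDegree_X_pow, hy, natDegree_pow, hfd]; omega)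
  rw [hP0, hQ0] at hPQ
  have : y ≠ 0 := pow_ne_zero _ (ff_ne a b)
  apply this; rw [← hPQ]; simp

theorem coeff_eval {K : Type*} [Field K] (p : ℕ) [Fact p.Prime] [CharP K p] (r : K) (G : K[X])
    (hG : G.natDegree < p) : ((X - C r) ^ (p - 1) * G).coeff (p - 1) = G.eval r := by
  have hp : p.Prime := Fact.out
  have hp1 := hp.one_lt
  have hmon : (X - C r).Monic := monic_X_sub_C r
  have h1 : G = C (G.eval r) + (X - C r) * (G /ₘ (X - C r)) := by
    conv_lhs => rw [← modByMonic_add_div G (X - C r), modByMonic_X_sub_C_eq_C_eval]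
  set H := G /ₘ (X - C r)
  have hH : H.coeff (p - 1) = 0 := by
    apply coeff_eq_zero_of_natDegree_lt
    rw [natDegree_divByMonic _ hmon, natDegree_X_sub_C]; omega
  have h2 : (X - C r) ^ (p - 1) * G = C (G.eval r) * (X - C r) ^ (p - 1) + (X ^ p * H - C (r ^ p) * H) := by
    have : (X - C r) ^ p = X ^ p - C (r ^ p) := by rw [sub_pow_char, C_pow]
    have h3 : (X - C r) ^ p = (X - C r) ^ (p - 1) * (X - C r) := by
      rw [← pow_succ]; congr 1; omega
    conv_lhs => rw [h1]
    rw [← sub_mul, ← this, h3]; ring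
  rw [h2, coeff_add, coeff_sub, coeff_C_mul, coeff_C_mul, hH, coeff_X_pow_mul', if_neg (by omega)]
  have h4 : ((X - C r) ^ (p - 1)).coeff (p - 1) = 1 := by
    have := (hmon.pow (p - 1)).coeff_natDegree
    rwa [natDegree_pow, natDegree_X_sub_C, mul_one] at this
  rw [h4]; ring

theorem nodal_case {K : Type*} [Field K] (p m : ℕ) [Fact p.Prime] [CharP K p] (hpm : p = 2 * m + 1)
    (hp5 : 5 ≤ p) (r : K) (hr : r ≠ 0) : ((ff (-3 * r ^ 2) (2 * r ^ 3)) ^ m).coeff (p - 1) ≠ 0 := by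
  have h1 : ff (-3 * r ^ 2) (2 * r ^ 3) = (X - C r) ^ 2 * (X + C (2 * r)) := by
    have h3 : (C (3 : K) : K[X]) = 3 := rfl
    have h2 : (C (2 : K) : K[X]) = 2 := rfl
    simp only [ff, C_mul, C_neg, C_pow, h3, h2]; ring
  have h2 : (X - C r) ^ (p - 1) = ((X - C r) ^ 2) ^ m := by rw [← pow_mul]; congr 1; omega
  rw [h1, mul_pow, ← h2, coeff_eval]
  · have h3 : (3 : K) ≠ 0 := by
      have : ((3 : ℕ) : K) ≠ 0 := by
        rw [Ne, CharP.cast_eq_zero_iff K p]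
        intro hd
        have := Nat.le_of_dvd (by omega) hd
        omega
      exact_mod_cast this
    have : eval r ((X + C (2 * r)) ^ m) = (3 * r) ^ m := by simp; ring
    rw [this]
    exact pow_ne_zero _ (mul_ne_zero h3 hr)
  · rw [natDegree_pow, natDegree_X_add_C]; omega

theorem point_case {K : Type*} [Field K] (p m : ℕ) [Fact p.Prime] [CharP K p] (hpm : p = 2 * m + 5)
    (a b : K) (hab : a ≠ 0 ∨ b ≠ 0)
    (h0 : ((ff a b) ^ (m + 2)).coeff (p - 1) = 0)
    (h1 : ((ff a b) ^ (m + 1)).coeff (p - 1) = 0) (h2 : ((ff a b) ^ (m + 1)).coeff (p - 2) = 0) :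
    False := by
  by_cases hD : 4 * a ^ 3 + 27 * b ^ 2 = 0
  · have hp : p.Prime := Fact.out
    have h3 : (3 : K) ≠ 0 := by
      have : ((3 : ℕ) : K) ≠ 0 := by
        rw [Ne, CharP.cast_eq_zero_iff K p]
        intro hd
        have := Nat.le_of_dvd (by omega) hd
        omega
      exact_mod_cast this
    have h2' : (2 : K) ≠ 0 := by
      have : ((2 : ℕ) : K) ≠ 0 := by
        rw [Ne, CharP.cast_eq_zero_iff K p]
        intro hd
        have := Nat.le_of_dvd (by omega) hd
        omega
      exact_mod_cast this
    have h27 : (27 : K) = 3 ^ 3 := by norm_num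
    have h4 : (4 : K) = 2 ^ 2 := by norm_num
    have ha : a ≠ 0 := by
      rintro rfl
      have hb : b ≠ 0 := by simpa using hab
      have : (27 : K) * b ^ 2 = 0 := by linear_combination hD
      rw [h27] at this
      exact mul_ne_zero (pow_ne_zero _ h3) (pow_ne_zero _ hb) this
    have hb : b ≠ 0 := by
      rintro rfl
      have : (4 : K) * a ^ 3 = 0 := by linear_combination hD
      rw [h4] at this
      exact mul_ne_zero (pow_ne_zero _ h2') (pow_ne_zero _ ha) this
    obtain ⟨r, hr⟩ : ∃ r, r * (2 * a) = -3 * b := ⟨-3 * b / (2 * a), by field_simp⟩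
    have hr0 : r ≠ 0 := by
      rintro rfl
      have : (3 : K) * b = 0 := by linear_combination hr
      exact mul_ne_zero h3 hb this
    have e1 : -3 * r ^ 2 = a := by
      apply mul_left_cancel₀ (pow_ne_zero 2 (mul_ne_zero h2' ha))
      linear_combination (-3 * (r * (2 * a)  - 3 * b)) * hr - hD
    have e2 : 2 * r ^ 3 = b := by
      apply mul_left_cancel₀ h3
      have : r * (-3 * r ^ 2) * 2 = -3 * b := by rw [e1]; linear_combination hr
      linear_combination -this
    have := nodal_case p (m + 2) (by omega) (by omega) r hr0
    rw [e1, e2] at this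
    exact this h0
  · exact smooth_case p m hpm a b hD h1 h2

theorem zero_exists {K : Type*} [Field K] [IsAlgClosed K] (g : MvPolynomial (Fin 2) K)
    (hg : g ≠ 0) (hu : ¬ IsUnit g) : ∃ a b : K, (a ≠ 0 ∨ b ≠ 0) ∧ MvPolynomial.eval ![a, b] g = 0 := by
  by_contra! hcon
  have key1 : ∀ b : K, b ≠ 0 → ∀ a a' : K,
      MvPolynomial.eval ![a, b] g = MvPolynomial.eval ![a', b] g := by
    intro b hb a a'
    set q : K[X] := MvPolynomial.aeval ![X, C b] g with hq
    have hev : ∀ t, q.eval t = MvPolynomial.eval ![t, b] g := by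
      intro t
      have : (evalRingHom t).comp (MvPolynomial.aeval (R := K) ![X, C b]).toRingHom
          = MvPolynomial.eval ![t, b] := by
        apply MvPolynomial.ringHom_ext
        · intro r; simp
        · intro i; fin_cases i <;> simp
      exact DFunLike.congr_fun this g
    by_cases hd : q.degree = 0
    · rw [← hev, ← hev, eq_C_of_degree_eq_zero hd]; simp
    · obtain ⟨t, ht⟩ := IsAlgClosed.exists_root q hd
      exact absurd ((hev t).symm.trans ht) (hcon t b (Or.inr hb))
  have key2 : ∀ a : K, a ≠ 0 → ∀ b b' : K,
      MvPolynomial.eval ![a, b] g = MvPolynomial.eval ![a, b'] g := by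
    intro a ha b b'
    set q : K[X] := MvPolynomial.aeval ![C a, X] g with hq
    have hev : ∀ t, q.eval t = MvPolynomial.eval ![a, t] g := by
      intro t
      have : (evalRingHom t).comp (MvPolynomial.aeval (R := K) ![C a, X]).toRingHom
          = MvPolynomial.eval ![a, t] := by
        apply MvPolynomial.ringHom_ext
        · intro r; simp
        · intro i; fin_cases i <;> simp
      exact DFunLike.congr_fun this g
    by_cases hd : q.degree = 0
    · rw [← hev, ← hev, eq_C_of_degree_eq_zero hd]; simp
    · obtain ⟨t, ht⟩ := IsAlgClosed.exists_root q hd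
      exact absurd ((hev t).symm.trans ht) (hcon a t (Or.inl ha))
  set r := MvPolynomial.eval ![1, 1] g with hr
  have : Infinite K := IsAlgClosed.instInfinite
  have hz : MvPolynomial.X 0 * MvPolynomial.X 1 * (g - MvPolynomial.C r) = 0 := by
    apply MvPolynomial.funext
    intro x
    have hx : x = ![x 0, x 1] := by ext i; fin_cases i <;> rfl
    simp only [map_mul, map_sub, MvPolynomial.eval_X, MvPolynomial.eval_C, map_zero]
    by_cases h0 : x 0 = 0
    · simp [h0]
    by_cases h1 : x 1 = 0
    · simp [h1]
    have : MvPolynomial.eval x g = r := by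
      rw [hx, key1 _ h1 (x 0) 1, key2 1 one_ne_zero (x 1) 1]
    rw [this]; ring
  have hgC : g = MvPolynomial.C r := by
    rw [mul_eq_zero, mul_eq_zero] at hz
    rcases hz with (h | h) | h
    · exact absurd h (MvPolynomial.X_ne_zero _)
    · exact absurd h (MvPolynomial.X_ne_zero _)
    · exact sub_eq_zero.mp h
  apply hu
  rw [hgC]
  refine IsUnit.map MvPolynomial.C (IsUnit.mk0 _ ?_)
  intro h0
  rw [h0, map_zero] at hgC
  exact hg hgC

theorem map_cAB {p : ℕ} {S : Type*} [CommRing S] (φ : MvPolynomial (Fin 2) (ZMod p) →+* S) :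
    φ (cAB p) = ((ff (φ (MvPolynomial.X 0)) (φ (MvPolynomial.X 1))) ^ ((p - 1) / 2)).coeff (p - 1) := by
  rw [cAB, ← coeff_map]
  simp [ff, Polynomial.map_pow]

theorem dual_expand {K S : Type*} [Field K] [CommRing S] (ι : K →+* S) (e : S) (he' : e * e = 0)
    (a b u v : K) (m : ℕ) : (ff (ι a + e * ι u) (ι b + e * ι v)) ^ (m + 1)
     = (ff a b ^ (m + 1)).map ι + C e * (C (m + 1 : K) * ((ff a b) ^ m * (C u * X + C v))).map ι := by
  have h1 : ff (ι a + e * ι u) (ι b + e * ι v)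
      = (ff a b).map ι + C e * (C u * X + C v).map ι := by
    simp [ff]; ring
  obtain ⟨k, hk⟩ := powAddExpansion ((ff a b).map ι) (C e * (C u * X + C v).map ι) (m + 1)
  have he : (C e) ^ 2 = 0 := by
    rw [← C_pow, pow_two, he', C_0]
  rw [h1, hk, mul_pow, he, Nat.add_sub_cancel]
  have hmm : (C (m + 1 : K)).map ι = (m : S[X]) + 1 := by simp
  rw [Polynomial.map_mul, Polynomial.map_mul, Polynomial.map_pow, Polynomial.map_pow, hmm]
  push_cast
  ring

theorem dual_case {K : Type*} [Field K] (a b u v : K) (m n : ℕ)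
    (h : ((ff (algebraMap K (DualNumber K) a + DualNumber.eps * algebraMap K _ u)
      (algebraMap K (DualNumber K) b + DualNumber.eps * algebraMap K _ v)) ^ (m + 1)).coeff n = 0) :
    ((ff a b) ^ (m + 1)).coeff n = 0 ∧
      (m + 1 : K) * ((ff a b) ^ m * (C u * X + C v)).coeff n = 0 := by
  set ι := algebraMap K (DualNumber K) with hι
  have h2 := dual_expand ι DualNumber.eps DualNumber.eps_mul_eps a b u v m
  rw [h2, coeff_add, coeff_C_mul, coeff_map, coeff_map, coeff_C_mul] at h
  have hf := congrArg TrivSqZeroExt.fst h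
  have hs := congrArg TrivSqZeroExt.snd h
  constructor
  · simpa [hι, TrivSqZeroExt.algebraMap_eq_inl] using hf
  · simpa [hι, TrivSqZeroExt.algebraMap_eq_inl] using hs

theorem homog_aux {R : Type*} [CommRing R] [Nontrivial R] (m : ℕ) : ∀ n k : ℕ, n + k = 3 * m →
    MvPolynomial.IsWeightedHomogeneous (fun i : Fin 2 => if i = 0 then 2 else 3)
      (((ff (MvPolynomial.X 0 : MvPolynomial (Fin 2) R) (MvPolynomial.X 1)) ^ m).coeff n) k := by
  induction m with
  | zero =>
    intro n k h
    obtain ⟨rfl, rfl⟩ : n = 0 ∧ k = 0 := by omega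
    simpa using MvPolynomial.isWeightedHomogeneous_one R _
  | succ m ih =>
    intro n k h
    set y := (ff (MvPolynomial.X 0 : MvPolynomial (Fin 2) R) (MvPolynomial.X 1)) ^ m with hy
    have hdeg : ∀ n, 3 * m < n → y.coeff n = 0 := by
      intro n hn
      apply coeff_eq_zero_of_natDegree_lt
      refine lt_of_le_of_lt natDegree_pow_le ?_
      rw [ff_natDegree]; omega
    have h1 : (ff (MvPolynomial.X 0 : MvPolynomial (Fin 2) R) (MvPolynomial.X 1)) ^ (m + 1)
        = X ^ 3 * y + C (MvPolynomial.X 0) * (X ^ 1 * y) + C (MvPolynomial.X 1) * y := by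
      rw [pow_succ, ← hy, ff]; ring
    rw [h1, coeff_add, coeff_add, coeff_C_mul, coeff_C_mul, coeff_X_pow_mul', coeff_X_pow_mul']
    refine MvPolynomial.IsWeightedHomogeneous.add (MvPolynomial.IsWeightedHomogeneous.add ?_ ?_) ?_
    · split_ifs
      · exact ih _ _ (by omega)
      · exact MvPolynomial.isWeightedHomogeneous_zero _ _ _
    · split_ifs
      · by_cases hk : 2 ≤ k
        · have := (MvPolynomial.isWeightedHomogeneous_X R
            (fun i : Fin 2 => if i = 0 then 2 else 3) 0).mul (ih (n - 1) (k - 2) (by omega))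
          convert this using 1
          simp; omega
        · rw [hdeg _ (by omega), mul_zero]
          exact MvPolynomial.isWeightedHomogeneous_zero _ _ _
      · rw [mul_zero]
        exact MvPolynomial.isWeightedHomogeneous_zero _ _ _
    · by_cases hk : 3 ≤ k
      · have := (MvPolynomial.isWeightedHomogeneous_X R
          (fun i : Fin 2 => if i = 0 then 2 else 3) 1).mul (ih n (k - 3) (by omega))
        convert this using 1
        simp; omega
      · rw [hdeg _ (by omega), mul_zero]
        exact MvPolynomial.isWeightedHomogeneous_zero _ _ _

theorem stmt16 (p : ℕ) [hp : Fact p.Prime] (hp5 : 5 ≤ p) :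
    cAB p ≠ 0 ∧
    MvPolynomial.IsWeightedHomogeneous (fun i : Fin 2 => if i = 0 then 2 else 3)
      (cAB p) ((p - 1) / 2) ∧
    Squarefree
      (MvPolynomial.map (algebraMap (ZMod p) (AlgebraicClosure (ZMod p))) (cAB p)) := by
  obtain ⟨m, hm⟩ : ∃ m, p = 2 * m + 5 := by
    have := hp.out.eq_two_or_odd
    exact ⟨(p - 5) / 2, by omega⟩
  have hm2 : (p - 1) / 2 = m + 2 := by omega
  have hne : cAB p ≠ 0 := by
    intro h
    have h1 := map_cAB (MvPolynomial.eval ![(-3 : ZMod p), 2])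
    rw [h, map_zero, hm2] at h1
    have h2 := nodal_case (K := ZMod p) p (m + 2) (by omega) hp5 1 one_ne_zero
    apply h2
    rw [h1]; simp
  refine ⟨hne, ?_, ?_⟩
  · exact homog_aux ((p - 1) / 2) (p - 1) ((p - 1) / 2) (by omega)
  · set K := AlgebraicClosure (ZMod p)
    have : CharP K p := charP_of_injective_algebraMap (algebraMap (ZMod p) K).injective p
    intro g hg
    by_contra hu
    have hinj := MvPolynomial.map_injective (σ := Fin 2) (algebraMap (ZMod p) K)
      (algebraMap (ZMod p) K).injective
    have hg0 : g ≠ 0 := by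
      rintro rfl
      rw [mul_zero, zero_dvd_iff] at hg
      exact hne (hinj (by rw [hg, map_zero]))
    obtain ⟨a, b, hab, hgz⟩ := zero_exists g hg0 hu
    obtain ⟨h, hh⟩ := hg
    have key : ∀ u v : K, ((ff a b) ^ (m + 1 + 1)).coeff (p - 1) = 0 ∧
      ((m + 1 : ℕ) + 1 : K) * ((ff a b) ^ (m + 1) * (C u * X + C v)).coeff (p - 1) = 0 := by
      intro u v
      apply dual_case
      let ψ : MvPolynomial (Fin 2) K →ₐ[K] DualNumber K := MvPolynomial.aeval
        ![algebraMap K (DualNumber K) a + DualNumber.eps * algebraMap K _ u,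
          algebraMap K (DualNumber K) b + DualNumber.eps * algebraMap K _ v]
      have hψ : TrivSqZeroExt.fst (ψ g) = 0 := by
        rw [← hgz]
        have : ((TrivSqZeroExt.fstHom K K K).comp ψ).toRingHom = MvPolynomial.eval ![a, b] := by
          apply MvPolynomial.ringHom_ext
          · intro r; simp
          · intro i; fin_cases i <;> simp [ψ, TrivSqZeroExt.algebraMap_eq_inl]
        exact DFunLike.congr_fun this g
      have hψ2 : ψ g * ψ g = 0 := by
        ext <;> simp [hψ]
      have h1 := map_cAB (ψ.toRingHom.comp (MvPolynomial.map (algebraMap (ZMod p) K)))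
      rw [hm2] at h1
      have h2 : (ψ.toRingHom.comp (MvPolynomial.map (algebraMap (ZMod p) K))) (cAB p) = 0 := by
        change ψ (MvPolynomial.map (algebraMap (ZMod p) K) (cAB p)) = 0
        rw [hh, map_mul, map_mul, hψ2, zero_mul]
      rw [h2] at h1
      rw [h1]
      simp [ψ]
      rfl
    have hmK : ((m + 1 : ℕ) + 1 : K) ≠ 0 := by
      have : ((m + 1 + 1 : ℕ) : K) ≠ 0 := by
        rw [Ne, CharP.cast_eq_zero_iff K p]
        intro hd
        have := Nat.le_of_dvd (by omega) hd
        omega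
      exact_mod_cast this
    have k1 := (mul_eq_zero.mp (key 0 1).2).resolve_left hmK
    have k2 := (mul_eq_zero.mp (key 1 0).2).resolve_left hmK
    refine point_case p m hm a b hab (key 0 0).1 ?_ ?_
    · simpa using k1
    · rw [show p - 1 = (p - 2) + 1 by omega] at k2
      simpa using k2
end

section
/- Let $p \ge 5$ be a prime and let $c_{A,B} \in \mathbb{F}_p[A,B]$ be the coefficient of $x^{p-1}$ in $(x^3 + Ax + B)^{(p-1)/2} \in \mathbb{F}_p[A,B][x]$. Then for every $\gamma \in \overline{\mathbb{F}}_p^\times$, the polynomial $c_{A,B} - \gamma$ is irreducible in $\overline{\mathbb{F}}_p[A,B]$. -/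
section Helpers

open Polynomial

/-- the family `y³ + y + s` over `K[s]` -/
noncomputable def fam (K : Type*) [Field K] : K[X][X] := X ^ 3 + X + C X

noncomputable def hh (K : Type*) [Field K] : K[X] := X ^ 3 + X

lemma fam_coeff {K : Type*} [Field K] (n N k : ℕ) :
    ((fam K ^ n).coeff N).coeff k = (n.choose k : K) * (hh K ^ (n - k)).coeff N := by
  have h1 : fam K = C X + (hh K).map C := by simp [fam, hh]; ring
  rw [h1, add_pow, finsetSum_coeff, finsetSum_coeff]
  have h2 : ∀ b ∈ Finset.range (n + 1),
      ((((C X : K[X][X]) ^ b * (hh K).map C ^ (n - b) * (n.choose b : K[X][X])).coeff N).coeff k)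
      = if k = b then (n.choose k : K) * (hh K ^ (n - k)).coeff N else 0 := by
    intro b _
    rw [← C_pow, mul_assoc, coeff_C_mul, ← Polynomial.map_pow, ← C_eq_natCast, coeff_mul_C,
      coeff_map, ← C_eq_natCast, ← C_mul, coeff_mul_C, coeff_X_pow]
    split_ifs with h
    · subst h; ring
    · ring
  rw [Finset.sum_congr rfl h2, Finset.sum_ite_eq]
  split_ifs with h
  · rfl
  · rw [Nat.choose_eq_zero_of_lt (by simpa using h)]; simp

lemma fam_deriv {K : Type*} [Field K] (n N : ℕ) :
    derivative ((fam K ^ (n + 1)).coeff N) = ((n + 1 : ℕ) : K[X]) * (fam K ^ n).coeff N := by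
  ext k
  rw [coeff_derivative, fam_coeff, ← C_eq_natCast, coeff_C_mul, fam_coeff]
  have := Nat.add_one_mul_choose_eq n k
  have h2 : ((n + 1 : ℕ) : K) * (n.choose k : K) = ((n+1).choose (k+1) : K) * (k + 1) := by
    have h3 := congrArg (Nat.cast : ℕ → K) this
    push_cast at h3 ⊢
    exact h3
  rw [← mul_assoc, h2, Nat.add_sub_add_right]
  ring

lemma fam_natDegree {K : Type*} [Field K] (n N : ℕ) : ((fam K ^ n).coeff N).natDegree ≤ n := by
  rw [natDegree_le_iff_coeff_eq_zero]
  intro k hk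
  rw [fam_coeff, Nat.choose_eq_zero_of_lt hk]; simp

lemma hh_coeff {K : Type*} [Field K] (n l : ℕ) :
    (hh K ^ n).coeff (n + 2 * l) = (n.choose l : K) := by
  have : hh K = X * (expand K 2 (X + 1)) := by simp [hh]; ring
  rw [this, mul_pow, add_comm n (2 * l), coeff_X_pow_mul, ← map_pow, mul_comm 2 l, coeff_expand_mul (by norm_num),
    coeff_X_add_one_pow]

lemma fam_ne_zero {K : Type*} [Field K] (p m : ℕ) [CharP K p] (hp : p.Prime) (hm : p = 2 * m + 1)
    (hm2 : 2 ≤ m) : (fam K ^ m).coeff (2 * m) ≠ 0 := by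
  have key : ∀ n l, n < p → l ≤ n → (n.choose l : K) ≠ 0 := by
    intro n l hn hl h
    rw [CharP.cast_eq_zero_iff K p] at h
    have h2 : p ∣ n.factorial := h.trans ⟨_, by rw [← mul_assoc, Nat.choose_mul_factorial_mul_factorial hl]⟩
    rw [hp.dvd_factorial] at h2
    omega
  intro h
  rcases Nat.even_or_odd' m with ⟨r, hr | hr⟩
  · have := congrArg (fun q => q.coeff 0) h
    simp only [coeff_zero] at this
    rw [fam_coeff, show 2 * m = (m - 0) + 2 * r by omega, hh_coeff] at this
    exact mul_ne_zero (key _ _ (by omega) (by omega)) (key _ _ (by omega) (by omega)) this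
  · have := congrArg (fun q => q.coeff 1) h
    simp only [coeff_zero] at this
    rw [fam_coeff, show 2 * m = (m - 1) + 2 * (r + 1) by omega, hh_coeff] at this
    exact mul_ne_zero (key _ _ (by omega) (by omega)) (key _ _ (by omega) (by omega)) this

lemma fam_ode {K : Type*} [Field K] (p m : ℕ) [CharP K p] (hp : p.Prime) (hm : p = 2 * m + 1)
    (hm2 : 2 ≤ m) (F : K[X]) (hF : F = (fam K ^ m).coeff (2 * m)) :
    (16 + 108 * X ^ 2) * derivative (derivative F) + 216 * X * derivative F + 15 * F = 0 := by
  obtain ⟨n, rfl⟩ : ∃ n, m = n + 2 := ⟨m - 2, by omega⟩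
  have e1 : derivative F = ((n + 2 : ℕ) : K[X]) * (fam K ^ (n + 1)).coeff (2 * (n + 2)) := by
    rw [hF, fam_deriv]
  have e2 : derivative (derivative F) = ((n + 2 : ℕ) : K[X]) * ((n + 1 : ℕ) : K[X]) *
      (fam K ^ n).coeff (2 * (n + 2)) := by
    rw [e1, ← C_eq_natCast, derivative_C_mul, fam_deriv, mul_assoc]
  have hz : ((2 * n + 5 : ℕ) : K[X]) = 0 := by
    rw [CharP.cast_eq_zero_iff K[X] p]; exact dvd_of_eq (by omega)
  have hz' : (2 * (n : K[X][X]) + 5) = 0 := by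
    have := congrArg (C : K[X] → K[X][X]) hz
    rw [C_eq_natCast, C_0] at this
    rw [← this]; push_cast; ring
  have h2 : (2 : K[X][X]) ≠ 0 := by
    have : ((2 : ℕ) : K[X][X]) ≠ 0 := by
      rw [Ne, CharP.cast_eq_zero_iff _ p]
      intro h; have := Nat.le_of_dvd (by norm_num) h; omega
    exact_mod_cast this
  -- exact differential
  have hd : (derivative (-((30 : K[X][X]) * X ^ 4 + 42 * X ^ 2 + 12 * C X * X + 8) * fam K ^ (n + 1))).coeff
      (2 * (n + 2)) = 0 := by
    rw [coeff_derivative]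
    have : ((2 * (n + 2) : ℕ) : K[X]) + 1 = 0 := by rw [← hz]; push_cast; ring
    rw [this, mul_zero]
  have hid : derivative (-((30 : K[X][X]) * X ^ 4 + 42 * X ^ 2 + 12 * C X * X + 8) * fam K ^ (n + 1)) =
      C ((16 + 108 * X ^ 2) * (((n + 2 : ℕ) : K[X]) * ((n + 1 : ℕ) : K[X]))) * fam K ^ n +
      C (216 * X * ((n + 2 : ℕ) : K[X])) * fam K ^ (n + 1) + C 15 * fam K ^ (n + 2) := by
    have hdf : derivative (fam K) = 3 * X ^ 2 + 1 := by
      simp only [fam, derivative_add, derivative_X_pow, derivative_X, derivative_C, C_eq_natCast]; norm_num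
    have cofn : ∀ k : ℕ, (C ((k : ℕ) : K[X]) : K[X][X]) = (k : K[X][X]) := fun k => by simp
    have c15 : (C 15 : K[X][X]) = 15 := by exact_mod_cast cofn 15
    have c16 : (C 16 : K[X][X]) = 16 := by exact_mod_cast cofn 16
    have c108 : (C 108 : K[X][X]) = 108 := by exact_mod_cast cofn 108
    have c216 : (C 216 : K[X][X]) = 216 := by exact_mod_cast cofn 216
    rw [derivative_mul, derivative_pow_succ, hdf]
    simp only [C_1, derivative_neg, derivative_add, derivative_mul, derivative_X_pow, derivative_C, derivative_X, derivative_ofNat, derivative_C, C_mul, C_add, C_pow, cofn, c15, c16, c108, c216]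
    push_cast
    apply mul_left_cancel₀ h2
    apply mul_left_cancel₀ h2
    have w1 : fam K ^ (n + 1) = fam K ^ n * (X ^ 3 + X + C X) := by rw [pow_succ]; rfl
    have w2 : fam K ^ (n + 2) = fam K ^ n * (X ^ 3 + X + C X) ^ 2 := by rw [pow_add]; rfl
    rw [w1, w2]
    generalize fam K ^ n = W
    linear_combination W * (-2 * (16 + 108 * C X ^ 2) * (n : K[X][X])
      - 2 * (30 * X ^ 4 + 42 * X ^ 2 + 12 * C X * X + 8) * (3 * X ^ 2 + 1)
      - (16 + 108 * C X ^ 2) - 432 * C X * (X ^ 3 + X + C X)) * hz'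
  rw [hid, coeff_add, coeff_add, coeff_C_mul, coeff_C_mul, coeff_C_mul] at hd
  rw [e2, e1]
  rw [hF]
  linear_combination hd

lemma simple_root {K : Type*} [Field K] (p : ℕ) [CharP K p] (hp : p.Prime) (hp5 : 5 ≤ p)
    (F : K[X]) (hF0 : F ≠ 0) (hdeg : F.natDegree < p)
    (ode : (16 + 108 * X ^ 2) * derivative (derivative F) + 216 * X * derivative F + 15 * F = 0)
    (a : K) (h0 : F.eval a = 0) : (derivative F).eval a ≠ 0 := by
  intro h1
  have hnat : ∀ n : ℕ, 0 < n → n < p → (n : K) ≠ 0 := by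
    intro n hn hn' h
    rw [CharP.cast_eq_zero_iff K p] at h
    exact absurd (Nat.le_of_dvd hn h) (by omega)
  have h2 : (2 : K) ≠ 0 := by exact_mod_cast hnat 2 (by norm_num) (by omega)
  have h3 : (3 : K) ≠ 0 := by exact_mod_cast hnat 3 (by norm_num) (by omega)
  set H := F.comp (X + C a) with hH
  have hd1 : (derivative F).comp (X + C a) = derivative H := by
    rw [hH, derivative_comp]; simp
  have hd2 : (derivative (derivative F)).comp (X + C a) = derivative (derivative H) := by
    rw [← hd1, derivative_comp]; simp
  have ode2 : (C (16 + 108 * a ^ 2) + C (216 * a) * X + C 108 * X ^ 2) * derivative (derivative H)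
      + (C 216 * X + C (216 * a)) * derivative H + C 15 * H = 0 := by
    have := congrArg (fun q => q.comp (X + C a)) ode
    simp only [add_comp, mul_comp, hd1, hd2, ← hH, zero_comp, pow_comp, X_comp, ofNat_comp] at this
    simp only [map_add, map_mul, map_pow, map_ofNat]
    linear_combination this
  have hc0 : H.coeff 0 = 0 := by
    rw [coeff_zero_eq_eval_zero, hH, eval_comp]; simpa using h0
  have hc1 : H.coeff 1 = 0 := by
    have : (derivative H).coeff 0 = 0 := by
      rw [coeff_zero_eq_eval_zero, ← hd1, eval_comp]; simpa using h1
    simpa [coeff_derivative] using this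
  -- recurrence
  have recu : ∀ n : ℕ, (16 + 108 * a ^ 2) * (H.coeff (n + 2) * (n + 2) * (n + 1)) +
      216 * a * (H.coeff (n + 1) * (n + 1) * n) + 108 * (H.coeff n * n * (n - 1)) +
      216 * (H.coeff n * n) + 216 * a * (H.coeff (n + 1) * (n + 1)) + 15 * H.coeff n = 0 := by
    intro n
    have := congrArg (fun q => q.coeff n) ode2
    simp only [add_mul, mul_assoc, coeff_add, coeff_C_mul, coeff_zero] at this
    rcases n with _ | _ | n
    · simp [coeff_derivative, pow_two, mul_assoc] at this ⊢
      linear_combination this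
    · simp [coeff_derivative, pow_two, mul_assoc, coeff_X_mul] at this ⊢
      linear_combination this
    · rw [coeff_X_pow_mul, coeff_X_mul, coeff_X_mul] at this
      simp [coeff_derivative] at this ⊢
      linear_combination this
  have all : ∀ n, n + 1 < p → H.coeff n = 0 ∧ H.coeff (n + 1) = 0 := by
    intro n
    induction n with
    | zero => intro _; exact ⟨hc0, hc1⟩
    | succ n ih =>
      intro hn
      obtain ⟨i0, i1⟩ := ih (by omega)
      refine ⟨i1, ?_⟩
      have n1 : ((n + 1 : ℕ) : K) ≠ 0 := hnat _ (by omega) (by omega)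
      have n2 : ((n + 2 : ℕ) : K) ≠ 0 := hnat _ (by omega) (by omega)
      push_cast at n1 n2
      by_cases q0 : 16 + 108 * a ^ 2 = 0
      · have ha : a ≠ 0 := by
          rintro rfl
          have : (2 : K) ^ 4 = 0 := by linear_combination q0
          exact h2 (pow_eq_zero_iff (by norm_num) |>.1 this)
        have r := recu (n + 1)
        rw [q0, i1] at r
        push_cast at r
        have : (2 ^ 3 * 3 ^ 3 * a * (n + 2) * (n + 2)) * H.coeff (n + 2) = 0 := by
          linear_combination r
        exact (mul_eq_zero.1 this).resolve_left (by simp [h2, h3, ha, n2])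
      · have r := recu n
        rw [i0, i1] at r
        have : ((16 + 108 * a ^ 2) * (n + 2) * (n + 1)) * H.coeff (n + 2) = 0 := by
          linear_combination r
        exact (mul_eq_zero.1 this).resolve_left (by simp [q0, n1, n2])
  have hHd : H.natDegree = F.natDegree := by
    rw [hH, natDegree_comp, natDegree_X_add_C, mul_one]
  have hHz : H = 0 := by
    ext n
    rw [coeff_zero]
    by_cases hn : n < p
    · rcases n with _ | n
      · exact hc0
      · exact (all n hn).2
    · exact coeff_eq_zero_of_natDegree_lt (by omega)
  apply hF0
  have : F = H.comp (X - C a) := by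
    rw [hH, comp_assoc]; simp
  rw [this, hHz, zero_comp]

lemma exists_simple_root {K : Type*} [Field K] [IsAlgClosed K] (p : ℕ) [CharP K p] (hp : p.Prime)
    (hp5 : 7 ≤ p)
    (F : K[X]) (hF0 : F ≠ 0) (hdeg : F.natDegree < p)
    (ode : (16 + 108 * X ^ 2) * derivative (derivative F) + 216 * X * derivative F + 15 * F = 0) :
    ∃ a, F.eval a = 0 ∧ (derivative F).eval a ≠ 0 := by
  have hnat : ∀ n : ℕ, 0 < n → n < p → (n : K) ≠ 0 := by
    intro n hn hn' h
    rw [CharP.cast_eq_zero_iff K p] at h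
    exact absurd (Nat.le_of_dvd hn h) (by omega)
  have h5 : (5 : K) ≠ 0 := by exact_mod_cast hnat 5 (by norm_num) (by omega)
  have h3 : (3 : K) ≠ 0 := by exact_mod_cast hnat 3 (by norm_num) (by omega)
  have hd : F.degree ≠ 0 := by
    intro hd
    rw [eq_C_of_degree_eq_zero hd] at ode hF0
    have h := congrArg (fun q => q.coeff 0) ode
    simp only [derivative_C, derivative_zero, mul_zero, zero_add, coeff_zero] at h
    rw [show (15 : K[X]) = C 15 from (C_eq_natCast 15).symm, ← C_mul, coeff_C_zero] at h
    have h' : (3 * 5 : K) * F.coeff 0 = 0 := by linear_combination h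
    have := (mul_eq_zero.1 h').resolve_left (mul_ne_zero h3 h5)
    simp [this] at hF0
  obtain ⟨a, ha⟩ := IsAlgClosed.exists_root F hd
  exact ⟨a, ha, simple_root p hp (by omega) F hF0 hdeg ode a ha⟩

lemma eis {K : Type*} [Field K] (F : K[X]) (a : K) (h0 : F.eval a = 0)
    (h1 : (derivative F).eval a ≠ 0) (γ : K) (hγ : γ ≠ 0) (m : ℕ) (hm : 0 < m) :
    Irreducible (C (C (-γ)) * X ^ m + C F : K[X][X]) := by
  have hu : IsUnit (C (-γ) : K[X]) := isUnit_C.2 (isUnit_iff_ne_zero.2 (neg_ne_zero.2 hγ))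
  have hnz : (C (-γ) : K[X]) ≠ 0 := hu.ne_zero
  set E := (C (C (-γ)) * X ^ m + C F : K[X][X]) with hE
  have hdeg : E.degree = m := by
    rw [hE, degree_add_eq_left_of_degree_lt, degree_C_mul_X_pow m hnz]
    rw [degree_C_mul_X_pow m hnz]
    exact lt_of_le_of_lt degree_C_le (by exact_mod_cast hm)
  have hlc : E.leadingCoeff = C (-γ) := by
    rw [leadingCoeff, natDegree_eq_of_degree_eq_some hdeg, hE]
    rw [coeff_add, coeff_C_mul, coeff_X_pow, if_pos rfl, mul_one, coeff_C, if_neg hm.ne', add_zero]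
  have hprime : (Ideal.span {X - C a}).IsPrime :=
    (Ideal.span_singleton_prime (X_sub_C_ne_zero a)).2 (prime_X_sub_C a)
  apply irreducible_of_eisenstein_criterion hprime
  · rw [hlc]
    intro h
    exact hprime.ne_top (Ideal.eq_top_of_isUnit_mem _ h hu)
  · intro n hn
    rw [hdeg] at hn
    have hn : n < m := by exact_mod_cast hn
    rw [Ideal.mem_span_singleton, hE, coeff_add, coeff_C_mul, coeff_X_pow, if_neg hn.ne, mul_zero,
      zero_add, coeff_C]
    split_ifs
    · exact dvd_iff_isRoot.2 h0
    · exact dvd_zero _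
  · rw [hdeg]; exact_mod_cast hm
  · rw [Ideal.span_singleton_pow, Ideal.mem_span_singleton, hE, coeff_add, coeff_C_mul, coeff_X_pow,
      if_neg hm.ne, mul_zero, zero_add, coeff_C_zero]
    rintro ⟨q, hq⟩
    apply h1
    rw [hq]; simp [derivative_mul, derivative_pow]
  · intro r hr
    have := (C_dvd_iff_dvd_coeff _ _).1 hr E.natDegree
    rw [coeff_natDegree, hlc] at this
    exact isUnit_of_dvd_unit this hu

lemma eis_rev {K : Type*} [Field K] (F : K[X]) (hF0 : F ≠ 0) (a : K) (h0 : F.eval a = 0)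
    (h1 : (derivative F).eval a ≠ 0) (γ : K) (hγ : γ ≠ 0) (m : ℕ) (hm : 0 < m) :
    Irreducible (C F * X ^ m + C (C (-γ)) : K[X][X]) := by
  have hu : IsUnit (C (-γ) : K[X]) := isUnit_C.2 (isUnit_iff_ne_zero.2 (neg_ne_zero.2 hγ))
  set E := (C F * X ^ m + C (C (-γ)) : K[X][X]) with hE
  have hdeg : E.natDegree = m := by
    rw [hE, natDegree_add_C, natDegree_C_mul_X_pow m F hF0]
  have hrev : E.reverse = C (C (-γ)) * X ^ m + C F := by
    ext1 n
    rw [coeff_reverse, hdeg, hE]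
    simp only [coeff_add, coeff_C_mul, coeff_X_pow, coeff_C]
    by_cases hn : n ≤ m
    · rw [revAt_le hn]
      rcases Nat.eq_zero_or_pos n with rfl | hn0
      · simp [hm.ne, hm.ne']
      · by_cases hnm : n = m
        · subst hnm; simp [hm.ne, hm.ne']
        · rw [if_neg (by omega), if_neg (by omega), if_neg (by omega), if_neg (by omega)]
          simp
    · rw [revAt_eq_self_of_lt (by omega), if_neg (by omega), if_neg (by omega), if_neg (by omega)]
      simp
  have hirr := eis F a h0 h1 γ hγ m hm
  rw [← hrev] at hirr
  have hE0 : E.coeff 0 = C (-γ) := by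
    rw [hE]; simp [hm.ne, coeff_X_pow]
  have aux : ∀ f g : K[X][X], E = f * g → IsUnit f.reverse → IsUnit f := by
    intro f g hfg hf
    have hc : f.coeff 0 * g.coeff 0 = C (-γ) := by rw [← mul_coeff_zero, ← hfg, hE0]
    have hfu : IsUnit (f.coeff 0) := isUnit_of_dvd_unit ⟨_, hc.symm⟩ hu
    have ht : f.natTrailingDegree = 0 := natTrailingDegree_eq_zero.2 (Or.inr hfu.ne_zero)
    have hd : f.natDegree = 0 := by
      rw [natDegree_eq_reverse_natDegree_add_natTrailingDegree, ht, natDegree_eq_zero_of_isUnit hf]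
    rw [eq_C_of_natDegree_eq_zero hd]
    exact isUnit_C.2 hfu
  constructor
  · intro h
    have := natDegree_eq_zero_of_isUnit h
    omega
  · intro f g hfg
    have := hirr.isUnit_or_isUnit (a := f.reverse) (b := g.reverse)
      (by rw [hfg, reverse_mul_of_domain])
    rcases this with h | h
    · exact Or.inl (aux f g hfg h)
    · exact Or.inr (aux g f (by rw [hfg, mul_comm]) h)

/-- `A ↦ t²`, `B ↦ s t³` -/
noncomputable def phi (K : Type*) [Field K] : MvPolynomial (Fin 2) K →ₐ[K] K[X][X] :=
  MvPolynomial.aeval ![X ^ 2, C X * X ^ 3]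

lemma phi_injective (K : Type*) [Field K] : Function.Injective (phi K) := by
  rw [injective_iff_map_eq_zero]
  intro f hf
  ext e
  rw [MvPolynomial.coeff_zero]
  have key : ∀ d : Fin 2 →₀ ℕ, ∀ a : K, ((phi K (MvPolynomial.monomial d a)).coeff
      (2 * e 0 + 3 * e 1)).coeff (e 1) = if d = e then a else 0 := by
    intro d a
    have : phi K (MvPolynomial.monomial d a) = C (C a * X ^ (d 1)) * X ^ (2 * d 0 + 3 * d 1) := by
      rw [phi, MvPolynomial.aeval_monomial, Finsupp.prod_fintype _ _ (by simp)]
      simp [Fin.prod_univ_two, Polynomial.algebraMap_apply]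
      ring
    rw [this, coeff_C_mul, coeff_X_pow, mul_ite, mul_one, mul_zero]
    by_cases h : d = e
    · subst h; simp
    · rw [if_neg h]
      split_ifs with h2
      · rw [coeff_C_mul, coeff_X_pow, if_neg, mul_zero]
        intro h3
        apply h
        ext i
        fin_cases i
        · simp; omega
        · simp; omega
      · simp
  have h := congrArg (fun q => (q.coeff (2 * e 0 + 3 * e 1)).coeff (e 1)) hf
  simp only [coeff_zero] at h
  rw [MvPolynomial.as_sum f, map_sum, finsetSum_coeff, finsetSum_coeff,
    Finset.sum_congr rfl (fun d _ => key d _), Finset.sum_ite_eq'] at h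
  by_contra hne
  rw [if_pos (MvPolynomial.mem_support_iff.2 hne)] at h
  exact hne h

lemma scale_coeff {R : Type*} [CommRing R] (s t : R) (m : ℕ) :
    ((X ^ 3 + C (t ^ 2) * X + C (s * t ^ 3)) ^ m).coeff (2 * m) * t ^ (2 * m) =
      t ^ (3 * m) * ((X ^ 3 + X + C s) ^ m).coeff (2 * m) := by
  have h2 : ((X ^ 3 + C (t ^ 2) * X + C (s * t ^ 3) : R[X]) ^ m).comp (C t * X) =
      C (t ^ (3 * m)) * (X ^ 3 + X + C s) ^ m := by
    rw [pow_comp, pow_mul, C_pow (a := t ^ 3), ← mul_pow]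
    congr 1
    simp
    ring
  have h3 := congrArg (fun q => q.coeff (2 * m)) h2
  simpa only [comp_C_mul_X_coeff, coeff_C_mul] using h3

lemma phi_cAB (p m : ℕ) [Fact p.Prime] (hm : p = 2 * m + 1) {K : Type*} [Field K] [Algebra (ZMod p) K] :
    phi K (MvPolynomial.map (algebraMap (ZMod p) K) (cAB p)) =
      C ((fam K ^ m).coeff (2 * m)) * X ^ m := by
  have h1 : phi K (MvPolynomial.map (algebraMap (ZMod p) K) (cAB p)) =
      ((X ^ 3 + C (X ^ 2) * X + C (C X * X ^ 3) : K[X][X][X]) ^ m).coeff (2 * m) := by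
    rw [cAB, show p - 1 = 2 * m by omega, show 2 * m / 2 = m by omega]
    rw [← coeff_map (MvPolynomial.map (algebraMap (ZMod p) K))]
    have : ∀ q : Polynomial (MvPolynomial (Fin 2) K), phi K (q.coeff (2 * m)) =
      (q.map (phi K : MvPolynomial (Fin 2) K →+* K[X][X])).coeff (2 * m) := by
      intro q; rw [coeff_map]; rfl
    rw [this]
    simp [phi]
  rw [h1]
  have h3 := scale_coeff (C X : K[X][X]) X m
  have h4 : ((X ^ 3 + X + C (C X) : K[X][X][X]) ^ m) = (fam K ^ m).map (C : K[X] →+* K[X][X]) := by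
    simp [fam]
  rw [h4, coeff_map, show 3 * m = 2 * m + m by ring, pow_add] at h3
  have hX : (X ^ (2 * m) : K[X][X]) ≠ 0 := pow_ne_zero _ X_ne_zero
  apply mul_right_cancel₀ hX
  rw [h3]; ring

lemma phi_reflect {K : Type*} [Field K] (q : MvPolynomial (Fin 2) K) (h : Irreducible (phi K q)) :
    Irreducible q := by
  have aux : ∀ f, IsUnit (phi K f) → IsUnit f := by
    intro f hf
    obtain ⟨r, hr, hr2⟩ := Polynomial.isUnit_iff.1 hf
    obtain ⟨a, ha, ha2⟩ := Polynomial.isUnit_iff.1 hr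
    have : f = MvPolynomial.C a := by
      apply phi_injective
      rw [← hr2, ← ha2, phi, MvPolynomial.aeval_C]; rfl
    rw [this]
    exact ha.map MvPolynomial.C
  constructor
  · intro hq; exact h.not_isUnit (hq.map (phi K))
  · intro f g hfg
    rcases h.isUnit_or_isUnit (by rw [hfg, map_mul]) with h' | h'
    · exact Or.inl (aux _ h')
    · exact Or.inr (aux _ h')

lemma case5 [Fact (Nat.Prime 5)] (K : Type*) [Field K] [Algebra (ZMod 5) K] (γ : K) :
    Irreducible (MvPolynomial.map (algebraMap (ZMod 5) K) (cAB 5) - MvPolynomial.C γ) := by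
  have hc : cAB 5 = 2 * MvPolynomial.X 0 := by
    rw [cAB]
    have : ((X ^ 3 + C (MvPolynomial.X 0) * X + C (MvPolynomial.X 1)) ^ ((5 - 1) / 2) :
      Polynomial (MvPolynomial (Fin 2) (ZMod 5))) = X ^ 6 + C (2 * MvPolynomial.X 0) * X ^ 4 +
        C (2 * MvPolynomial.X 1) * X ^ 3 + C (MvPolynomial.X 0 ^ 2) * X ^ 2 +
        C (2 * MvPolynomial.X 0 * MvPolynomial.X 1) * X ^ 1 + C (MvPolynomial.X 1 ^ 2) := by
      simp only [C_mul, C_pow, map_ofNat]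
      norm_num
      ring
    rw [this]
    simp only [coeff_add, coeff_C_mul, coeff_X_pow, coeff_C]
    norm_num
  have h2 : (2 : K) ≠ 0 := by
    have : CharP K 5 := charP_of_injective_algebraMap (algebraMap (ZMod 5) K).injective 5
    have : ((2 : ℕ) : K) ≠ 0 := by
      rw [Ne, CharP.cast_eq_zero_iff K 5]; norm_num
    exact_mod_cast this
  rw [hc, map_mul, map_ofNat, MvPolynomial.map_X]
  have e : (2 * MvPolynomial.X 0 - MvPolynomial.C γ : MvPolynomial (Fin 2) K) =
      MvPolynomial.C 2 * MvPolynomial.X 0 - MvPolynomial.C γ := by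
    rw [show (MvPolynomial.C 2 : MvPolynomial (Fin 2) K) = 2 from map_ofNat _ 2]
  have hcf : MvPolynomial.coeff (Finsupp.single 0 1)
      (2 * MvPolynomial.X 0 - MvPolynomial.C γ : MvPolynomial (Fin 2) K) = 2 := by
    rw [e, MvPolynomial.coeff_sub, MvPolynomial.coeff_C_mul, MvPolynomial.coeff_C, if_neg (by
      intro h; simpa using DFunLike.congr_fun h 0)]
    simp
  apply MvPolynomial.irreducible_of_totalDegree_eq_one
  · apply le_antisymm
    · rw [e]
      refine (MvPolynomial.totalDegree_sub _ _).trans (max_le ?_ (by simp))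
      refine (MvPolynomial.totalDegree_mul _ _).trans (by simp)
    · have := MvPolynomial.le_totalDegree (MvPolynomial.mem_support_iff.2 (hcf ▸ h2))
      simpa using this
  · intro x hx
    have := hx (Finsupp.single 0 1)
    rw [hcf] at this
    exact isUnit_of_dvd_unit this (isUnit_iff_ne_zero.2 h2)

end Helpers

theorem stmt17 (p : ℕ) [hp : Fact p.Prime] (hp5 : 5 ≤ p)
    (γ : AlgebraicClosure (ZMod p)) (hγ : γ ≠ 0) :
    Irreducible
      (MvPolynomial.map (algebraMap (ZMod p) (AlgebraicClosure (ZMod p))) (cAB p) -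
        MvPolynomial.C γ) := by
  obtain ⟨m, hm⟩ : ∃ m, p = 2 * m + 1 := hp.out.odd_of_ne_two (by omega)
  by_cases h5 : p = 5
  · subst h5
    exact case5 _ γ
  · have h6 : p ≠ 6 := by rintro rfl; exact absurd hp.out (by norm_num)
    have hch : CharP (AlgebraicClosure (ZMod p)) p :=
      charP_of_injective_algebraMap (algebraMap (ZMod p) (AlgebraicClosure (ZMod p))).injective p
    have hF0 := fam_ne_zero (K := AlgebraicClosure (ZMod p)) p m hp.out hm (by omega)
    have ode := fam_ode (K := AlgebraicClosure (ZMod p)) p m hp.out hm (by omega) _ rfl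
    obtain ⟨a, h0, h1⟩ := exists_simple_root p hp.out (by omega) _ hF0
      (lt_of_le_of_lt (fam_natDegree _ _) (by omega)) ode
    have hirr := eis_rev _ hF0 a h0 h1 γ hγ m (by omega)
    apply phi_reflect
    rw [map_sub, phi_cAB p m hm]
    have : phi (AlgebraicClosure (ZMod p)) (MvPolynomial.C γ) = Polynomial.C (Polynomial.C γ) := by
      rw [phi, MvPolynomial.aeval_C]; rfl
    rw [this, sub_eq_add_neg, ← Polynomial.C_neg, ← Polynomial.C_neg]
    exact hirr
end
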